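/- arXiv:1907.01323 — 8 statements merged into one kernel-verified Lean document; each statement's English description precedes it below -/
import Mathlib

section
/- The Shapley–Shubik index Ψ for interval simple games is positive, efficient, anonymous, symmetric, and satisfies both the null player property and the transfer property. -/
open MeasureTheory

/-- The unit cube `[0,1]^n`. -/
def cube (n : ℕ) : Set (Fin n → ℝ) := {x | ∀ i, x i ∈ Set.Icc (0 : ℝ) 1}

/-- An interval simple game: a function `[0,1]^n → [0,1]` with `v(0)=0`, `v(1)=1`,
monotone on the cube. -/
def IsISG (n : ℕ) (v : (Fin n → ℝ) → ℝ) : Prop :=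
  v (fun _ => 0) = 0 ∧ v (fun _ => 1) = 1 ∧
  (∀ x ∈ cube n, v x ∈ Set.Icc (0 : ℝ) 1) ∧
  (∀ x ∈ cube n, ∀ y ∈ cube n, (∀ i, x i ≤ y i) → v x ≤ v y)

/-- The Shapley–Shubik index `Ψ` for interval simple games. -/
noncomputable def Psi (n : ℕ) (v : (Fin n → ℝ) → ℝ) (i : Fin n) : ℝ :=
  (1 / (n.factorial : ℝ)) * ∑ π : Equiv.Perm (Fin n),
    ∫ x in cube n,
      ((v (fun j => if π j < π i then x j else 1) -
        v (fun j => if π j < π i then x j else 0)) -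
       (v (fun j => if π j ≤ π i then x j else 1) -
        v (fun j => if π j ≤ π i then x j else 0)))

/-- Player `i` is a null player in `v`: the value does not depend on coordinate `i`. -/
def NullPlayer (n : ℕ) (v : (Fin n → ℝ) → ℝ) (i : Fin n) : Prop :=
  ∀ x ∈ cube n, ∀ y ∈ cube n, (∀ j, j ≠ i → x j = y j) → v x = v y

/-- Players `i` and `j` are symmetric in `v`. -/
def SymPlayers (n : ℕ) (v : (Fin n → ℝ) → ℝ) (i j : Fin n) : Prop :=
  ∀ x ∈ cube n, v (fun k => x (Equiv.swap i j k)) = v x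

/-- Efficiency of a power index. -/
def Efficient (n : ℕ) (Φ : ((Fin n → ℝ) → ℝ) → Fin n → ℝ) : Prop :=
  ∀ v, IsISG n v → ∑ i, Φ v i = 1

/-- Positivity of a power index. -/
def Positive (n : ℕ) (Φ : ((Fin n → ℝ) → ℝ) → Fin n → ℝ) : Prop :=
  ∀ v, IsISG n v → Φ v ≠ 0 ∧ ∀ i, 0 ≤ Φ v i

/-- Anonymity of a power index: `Φ_{π(i)}(πv) = Φ_i(v)` where `(πv)(x) = v(x ∘ π)`. -/
def Anonymous (n : ℕ) (Φ : ((Fin n → ℝ) → ℝ) → Fin n → ℝ) : Prop :=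
  ∀ v, IsISG n v → ∀ π : Equiv.Perm (Fin n), ∀ i : Fin n,
    Φ (fun x => v (fun j => x (π j))) (π i) = Φ v i

/-- Symmetry of a power index: symmetric players obtain the same value. -/
def SymmetricIdx (n : ℕ) (Φ : ((Fin n → ℝ) → ℝ) → Fin n → ℝ) : Prop :=
  ∀ v, IsISG n v → ∀ i j : Fin n, SymPlayers n v i j → Φ v i = Φ v j

/-- The null player property of a power index. -/
def NullPlayerProp (n : ℕ) (Φ : ((Fin n → ℝ) → ℝ) → Fin n → ℝ) : Prop :=
  ∀ v, IsISG n v → ∀ i : Fin n, NullPlayer n v i → Φ v i = 0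

/-- The transfer property of a power index. -/
def Transfer (n : ℕ) (Φ : ((Fin n → ℝ) → ℝ) → Fin n → ℝ) : Prop :=
  ∀ u v, IsISG n u → IsISG n v → ∀ i : Fin n,
    Φ u i + Φ v i = Φ (fun x => max (u x) (v x)) i + Φ (fun x => min (u x) (v x)) i

section AEMeasurability

/-- A real function whose strict superlevel sets are null measurable is a.e. measurable. -/
theorem aemeasurable_of_nullMeasurableSet_Ioi {α : Type*} [MeasurableSpace α] {μ : Measure α}
    {f : α → ℝ} (hf : ∀ c, NullMeasurableSet (f ⁻¹' Set.Ioi c) μ) : AEMeasurable f μ := by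
  choose A hAm hA using fun q : ℚ => (hf q).exists_measurable_superset_ae_eq.imp
    fun _ h => h.2
  have hae : ∀ᵐ x ∂μ, ∀ q : ℚ, x ∈ A q ↔ x ∈ f ⁻¹' Set.Ioi (q : ℝ) :=
    ae_all_iff.2 fun q => (hA q).mem_iff
  set M := toMeasurable μ {x | ¬ ∀ q : ℚ, x ∈ A q ↔ x ∈ f ⁻¹' Set.Ioi (q : ℝ)} with hM
  have hMm : MeasurableSet M := measurableSet_toMeasurable _ _
  have hM0 : μ M = 0 := by rw [hM, measure_toMeasurable]; exact ae_iff.1 hae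
  have hMA : ∀ x ∉ M, ∀ q : ℚ, x ∈ A q ↔ x ∈ f ⁻¹' Set.Ioi (q : ℝ) := by
    intro x hx
    by_contra h
    exact hx (subset_toMeasurable _ _ h)
  refine ⟨Mᶜ.indicator f, ?_, ?_⟩
  · rw [BorelSpace.measurable_eq (α := ℝ), Real.borel_eq_generateFrom_Ioi_rat]
    refine measurable_generateFrom ?_
    simp only [Set.mem_iUnion, Set.mem_singleton_iff]
    rintro _ ⟨q, rfl⟩
    have : Mᶜ.indicator f ⁻¹' Set.Ioi (q : ℝ) =
        (Mᶜ ∩ A q) ∪ (M ∩ {_x | (q : ℝ) < 0}) := by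
      ext x
      by_cases hx : x ∈ M
      · simp [hx]
      · simp [hx, hMA x hx q]
    rw [this]
    exact (hMm.compl.inter (hAm q)).union (hMm.inter (MeasurableSet.const _))
  · filter_upwards [measure_eq_zero_iff_ae_notMem.1 hM0] with x hx
    rw [Set.indicator_of_mem (by exact hx)]

/-- Monotone real functions on `ℝ^ι` are a.e. measurable. -/
theorem Monotone.aemeasurable_pi {ι : Type*} [Fintype ι] {f : (ι → ℝ) → ℝ} (hf : Monotone f) :
    AEMeasurable f :=
  aemeasurable_of_nullMeasurableSet_Ioi fun c =>
    ((isUpperSet_Ioi c).preimage hf).ordConnected.nullMeasurableSet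

end AEMeasurability

section Cube

variable {n : ℕ}

theorem cube_eq_pi (n : ℕ) : cube n = Set.univ.pi fun _ => Set.Icc (0 : ℝ) 1 := by
  ext x
  simp only [cube, Set.mem_ofPred_eq, Set.mem_univ_pi]

theorem measurableSet_cube (n : ℕ) : MeasurableSet (cube n) := by
  rw [cube_eq_pi]
  exact MeasurableSet.univ_pi fun _ => measurableSet_Icc

theorem volume_cube (n : ℕ) : volume (cube n) = 1 := by
  rw [cube_eq_pi, volume_pi_pi]
  simp

theorem setIntegral_cube_comp_perm (σ : Equiv.Perm (Fin n)) (g : (Fin n → ℝ) → ℝ) :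
    ∫ x in cube n, g (fun j => x (σ j)) = ∫ x in cube n, g x := by
  have happ : ∀ x : Fin n → ℝ,
      MeasurableEquiv.piCongrLeft (fun _ => ℝ) σ.symm x = fun j => x (σ j) := by
    intro x
    funext j
    have := MeasurableEquiv.piCongrLeft_apply_apply σ.symm (β := fun _ => ℝ) x (σ j)
    simpa using this
  have h := (volume_measurePreserving_piCongrLeft (fun _ => ℝ) σ.symm).setIntegral_preimage_emb
    (MeasurableEquiv.measurableEmbedding _) g (cube n)
  have hpre : MeasurableEquiv.piCongrLeft (fun _ => ℝ) σ.symm ⁻¹' cube n = cube n := by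
    ext x
    simp only [Set.mem_preimage, happ, cube, Set.mem_ofPred_eq]
    exact σ.forall_congr_right (q := fun i => x i ∈ Set.Icc (0 : ℝ) 1)
  rw [hpre] at h
  simpa only [happ] using h

/-- The profile equal to `x` on the players satisfying `p` and to `c` elsewhere. -/
def fill (p : Fin n → Prop) [DecidablePred p] (c : ℝ) (x : Fin n → ℝ) : Fin n → ℝ :=
  fun j => if p j then x j else c

theorem fill_mem_cube (p : Fin n → Prop) [DecidablePred p] {c : ℝ} (hc : c ∈ Set.Icc (0 : ℝ) 1)
    {x : Fin n → ℝ} (hx : x ∈ cube n) : fill p c x ∈ cube n := by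
  intro j
  unfold fill
  split_ifs
  exacts [hx j, hc]

theorem fill_of_forall {p : Fin n → Prop} [DecidablePred p] (hp : ∀ j, p j) (c : ℝ)
    (x : Fin n → ℝ) : fill p c x = x :=
  funext fun j => if_pos (hp j)

theorem fill_of_forall_not {p : Fin n → Prop} [DecidablePred p] (hp : ∀ j, ¬ p j) (c : ℝ)
    (x : Fin n → ℝ) : fill p c x = fun _ => c :=
  funext fun j => if_neg (hp j)

end Cube

section Games

variable {n : ℕ} {u v : (Fin n → ℝ) → ℝ}

/-- The uncertainty left once the players satisfying `p` have fixed their votes as in `x`. -/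
def gap (v : (Fin n → ℝ) → ℝ) (p : Fin n → Prop) [DecidablePred p] (x : Fin n → ℝ) : ℝ :=
  v (fill p 1 x) - v (fill p 0 x)

theorem gap_congr_pred (v : (Fin n → ℝ) → ℝ) {p q : Fin n → Prop} [DecidablePred p]
    [DecidablePred q] (hpq : ∀ j, p j ↔ q j) : gap v p = gap v q := by
  obtain rfl : p = q := funext fun j => propext (hpq j)
  congr!

theorem Psi_eq_gap (v : (Fin n → ℝ) → ℝ) (i : Fin n) :
    Psi n v i = (1 / (n.factorial : ℝ)) * ∑ π : Equiv.Perm (Fin n),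
      ∫ x in cube n, (gap v (fun j => π j < π i) x - gap v (fun j => π j ≤ π i) x) :=
  rfl

theorem IsISG.integrableOn_fill (hv : IsISG n v) (p : Fin n → Prop) [DecidablePred p] {c : ℝ}
    (hc : c ∈ Set.Icc (0 : ℝ) 1) : IntegrableOn (fun x => v (fill p c x)) (cube n) := by
  have hclamp : ∀ x : Fin n → ℝ, (fun j => max 0 (min 1 (x j))) ∈ cube n := fun x j =>
    ⟨le_max_left _ _, max_le zero_le_one (min_le_left _ _)⟩
  have hmono : Monotone fun x : Fin n → ℝ => v (fill p c fun j => max 0 (min 1 (x j))) := by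
    intro x y hxy
    refine hv.2.2.2 _ (fill_mem_cube p hc (hclamp x)) _ (fill_mem_cube p hc (hclamp y)) fun j => ?_
    unfold fill
    split_ifs
    · exact max_le_max le_rfl (min_le_min le_rfl (hxy j))
    · exact le_rfl
  have hint : IntegrableOn (fun x : Fin n → ℝ => v (fill p c fun j => max 0 (min 1 (x j))))
      (cube n) := by
    refine Measure.integrableOn_of_bounded (M := 1) (by simp [volume_cube])
      hmono.aemeasurable_pi.aestronglyMeasurable (Filter.Eventually.of_forall fun x => ?_)
    have h := hv.2.2.1 _ (fill_mem_cube p hc (hclamp x))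
    rw [Real.norm_of_nonneg h.1]
    exact h.2
  refine hint.congr_fun (fun x hx => ?_) (measurableSet_cube n)
  have : (fun j => max 0 (min 1 (x j))) = x := by
    funext j
    rw [min_eq_right (hx j).2, max_eq_right (hx j).1]
  simp only [this]

theorem IsISG.integrableOn_gap (hv : IsISG n v) (p : Fin n → Prop) [DecidablePred p] :
    IntegrableOn (gap v p) (cube n) :=
  (hv.integrableOn_fill p ⟨zero_le_one, le_rfl⟩).sub (hv.integrableOn_fill p ⟨le_rfl, zero_le_one⟩)

theorem IsISG.gap_anti (hv : IsISG n v) {p q : Fin n → Prop} [DecidablePred p] [DecidablePred q]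
    (hpq : ∀ j, p j → q j) {x : Fin n → ℝ} (hx : x ∈ cube n) : gap v q x ≤ gap v p x := by
  have h0 : (0 : ℝ) ∈ Set.Icc (0 : ℝ) 1 := ⟨le_rfl, zero_le_one⟩
  have h1 : (1 : ℝ) ∈ Set.Icc (0 : ℝ) 1 := ⟨zero_le_one, le_rfl⟩
  refine sub_le_sub (hv.2.2.2 _ (fill_mem_cube q h1 hx) _ (fill_mem_cube p h1 hx) fun j => ?_)
    (hv.2.2.2 _ (fill_mem_cube p h0 hx) _ (fill_mem_cube q h0 hx) fun j => ?_)
  · by_cases hp : p j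
    · simp [fill, hp, hpq j hp]
    · by_cases hq : q j <;> simp [fill, hp, hq, (hx j).2]
  · by_cases hp : p j
    · simp [fill, hp, hpq j hp]
    · by_cases hq : q j <;> simp [fill, hp, hq, (hx j).1]

theorem IsISG.max (hu : IsISG n u) (hv : IsISG n v) : IsISG n fun x => max (u x) (v x) := by
  refine ⟨by simp [hu.1, hv.1], by simp [hu.2.1, hv.2.1], fun x hx => ?_, fun x hx y hy h => ?_⟩
  · exact ⟨le_max_of_le_left (hu.2.2.1 x hx).1, max_le (hu.2.2.1 x hx).2 (hv.2.2.1 x hx).2⟩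
  · exact max_le_max (hu.2.2.2 x hx y hy h) (hv.2.2.2 x hx y hy h)

theorem IsISG.min (hu : IsISG n u) (hv : IsISG n v) : IsISG n fun x => min (u x) (v x) := by
  refine ⟨by simp [hu.1, hv.1], by simp [hu.2.1, hv.2.1], fun x hx => ?_, fun x hx y hy h => ?_⟩
  · exact ⟨le_min (hu.2.2.1 x hx).1 (hv.2.2.1 x hx).1, min_le_of_left_le (hu.2.2.1 x hx).2⟩
  · exact min_le_min (hu.2.2.2 x hx y hy h) (hv.2.2.2 x hx y hy h)

theorem gap_congr (huv : Set.EqOn u v (cube n)) (p : Fin n → Prop) [DecidablePred p] :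
    Set.EqOn (gap u p) (gap v p) (cube n) := fun x hx => by
  unfold gap
  rw [huv (fill_mem_cube p ⟨zero_le_one, le_rfl⟩ hx),
    huv (fill_mem_cube p ⟨le_rfl, zero_le_one⟩ hx)]

theorem Psi_congr (huv : Set.EqOn u v (cube n)) (i : Fin n) : Psi n u i = Psi n v i := by
  simp only [Psi_eq_gap]
  congr 1
  refine Finset.sum_congr rfl fun π _ => setIntegral_congr_fun (measurableSet_cube n) fun x hx => ?_
  simp only [gap_congr huv _ hx]

/-- In a fixed order of the players, the contributions telescope. -/
theorem IsISG.sum_integral_gap (hv : IsISG n v) (π : Equiv.Perm (Fin n)) :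
    ∑ i, ∫ x in cube n, (gap v (fun j => π j < π i) x - gap v (fun j => π j ≤ π i) x) = 1 := by
  set F : ℕ → ℝ := fun m => ∫ x in cube n, gap v (fun j => (π j : ℕ) < m) x with hF
  have hterm : ∀ i, ∫ x in cube n,
      (gap v (fun j => π j < π i) x - gap v (fun j => π j ≤ π i) x) =
        F (π i) - F (π i + 1) := by
    intro i
    rw [integral_sub (hv.integrableOn_gap _) (hv.integrableOn_gap _)]
    simp only [hF]
    rw [gap_congr_pred v fun j => Fin.lt_def (a := π j) (b := π i),
      gap_congr_pred v fun j => Fin.le_def.trans (Nat.lt_succ_iff (m := π j) (n := π i)).symm]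
  have hF0 : F 0 = 1 := by
    simp [hF, gap, fill_of_forall_not, hv.1, hv.2.1, Measure.real, volume_cube]
  have hFn : F n = 0 := by
    simp [hF, gap, fill_of_forall]
  rw [Finset.sum_congr rfl fun i _ => hterm i,
    Equiv.sum_comp π fun k : Fin n => F k - F (k + 1),
    Fin.sum_univ_eq_sum_range fun k => F k - F (k + 1), Finset.sum_range_sub', hF0, hFn, sub_zero]

end Games

section Properties

variable (n : ℕ)

theorem efficient_Psi : Efficient n (Psi n) := by
  intro v hv
  simp only [Psi_eq_gap]
  rw [← Finset.mul_sum, Finset.sum_comm]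
  simp only [hv.sum_integral_gap, Finset.sum_const, Finset.card_univ, Fintype.card_perm,
    Fintype.card_fin, nsmul_eq_mul, mul_one]
  exact one_div_mul_cancel (Nat.cast_ne_zero.2 n.factorial_ne_zero)

theorem positive_Psi : Positive n (Psi n) := by
  refine fun v hv => ⟨fun h => ?_, fun i => ?_⟩
  · simpa [h] using efficient_Psi n v hv
  · rw [Psi_eq_gap]
    refine mul_nonneg (by positivity) (Finset.sum_nonneg fun π _ =>
      setIntegral_nonneg (measurableSet_cube n) fun x hx => sub_nonneg.2 ?_)
    exact hv.gap_anti (fun j => le_of_lt) hx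

theorem anonymous_Psi : Anonymous n (Psi n) := by
  intro v _ π i
  simp only [Psi_eq_gap]
  congr 1
  refine (Finset.sum_congr rfl fun σ _ => ?_).trans (Equiv.sum_comp (Equiv.mulRight π) fun σ =>
    ∫ x in cube n, (gap v (fun j => σ j < σ i) x - gap v (fun j => σ j ≤ σ i) x))
  exact setIntegral_cube_comp_perm π fun x =>
    gap v (fun j => (σ * π) j < (σ * π) i) x - gap v (fun j => (σ * π) j ≤ (σ * π) i) x

theorem symmetricIdx_Psi : SymmetricIdx n (Psi n) := by
  intro v hv i j hij
  have h := anonymous_Psi n v hv (Equiv.swap i j) i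
  rw [Equiv.swap_apply_left] at h
  rw [← h]
  exact Psi_congr hij j

theorem nullPlayerProp_Psi : NullPlayerProp n (Psi n) := by
  intro v _ i hi
  have hfill : ∀ (π : Equiv.Perm (Fin n)) (c : ℝ), c ∈ Set.Icc (0 : ℝ) 1 → ∀ x ∈ cube n,
      v (fill (fun j => π j < π i) c x) = v (fill (fun j => π j ≤ π i) c x) := by
    intro π c hc x hx
    refine hi _ (fill_mem_cube _ hc hx) _ (fill_mem_cube _ hc hx) fun j hj => ?_
    have : π j ≠ π i := π.injective.ne hj
    simp [fill, lt_iff_le_and_ne, this]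
  rw [Psi_eq_gap, Finset.sum_eq_zero, mul_zero]
  refine fun π _ => setIntegral_eq_zero_of_forall_eq_zero fun x hx => ?_
  simp only [gap, hfill π 1 ⟨zero_le_one, le_rfl⟩ x hx, hfill π 0 ⟨le_rfl, zero_le_one⟩ x hx,
    sub_self]

theorem transfer_Psi : Transfer n (Psi n) := by
  intro u v hu hv i
  have hint {w} (hw : IsISG n w) (π : Equiv.Perm (Fin n)) : IntegrableOn
      (fun x => gap w (fun j => π j < π i) x - gap w (fun j => π j ≤ π i) x) (cube n) :=
    (hw.integrableOn_gap _).sub (hw.integrableOn_gap _)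
  simp only [Psi_eq_gap, ← mul_add, ← Finset.sum_add_distrib]
  congr 1
  refine Finset.sum_congr rfl fun π _ => ?_
  rw [← integral_add (hint hu π) (hint hv π),
    ← integral_add (hint (hu.max hv) π) (hint (hu.min hv) π)]
  congr 1
  funext x
  simp only [gap]
  linarith [max_add_min (u (fill (fun j => π j < π i) 1 x)) (v (fill (fun j => π j < π i) 1 x)),
    max_add_min (u (fill (fun j => π j < π i) 0 x)) (v (fill (fun j => π j < π i) 0 x)),
    max_add_min (u (fill (fun j => π j ≤ π i) 1 x)) (v (fill (fun j => π j ≤ π i) 1 x)),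
    max_add_min (u (fill (fun j => π j ≤ π i) 0 x)) (v (fill (fun j => π j ≤ π i) 0 x))]

end Properties

/-- The Shapley–Shubik index `Ψ` for interval simple games is positive,
efficient, anonymous, symmetric, and satisfies both the null player property and the
transfer property. -/
theorem Psi_properties (n : ℕ) (hn : 1 ≤ n) :
    Positive n (Psi n) ∧ Efficient n (Psi n) ∧ Anonymous n (Psi n) ∧
    SymmetricIdx n (Psi n) ∧ NullPlayerProp n (Psi n) ∧ Transfer n (Psi n) := by
  exact ⟨positive_Psi n, efficient_Psi n, anonymous_Psi n, symmetricIdx_Psi n, nullPlayerProp_Psi n,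
    transfer_Psi n⟩
end

section
/- Let w ∈ ℝ_{≥0}^n with Σ_{i=1}^n w_i = 1 and, for each i ∈ N, let f_i : [0,1] → [0,1] be weakly monotonically increasing with f_i(0) = 0 and f_i(1) = 1. Then the function f : [0,1]^n → [0,1] defined by f(x) = Σ_{i=1}^n w_i·f_i(x_i) is an interval simple game and Ψ_i(f) = w_i for all i ∈ N. -/
open MeasureTheory

/-- The unit cube has Lebesgue measure one. -/
theorem volume_real_cube (n : ℕ) : volume.real (cube n) = 1 := by
  have h : cube n = Set.Icc (fun _ => 0) (fun _ => 1) := by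
    ext x
    simp [cube, Pi.le_def, forall_and]
  simp [h, measureReal_def, Real.volume_Icc_pi]

/-- For a weighted sum of functions with `f_j(0) = 0` and `f_j(1) = 1`, the marginal reduction of
uncertainty caused by player `i` is always `w_i`. -/
theorem weighted_sum_marginal (n : ℕ) (w : Fin n → ℝ) (f : Fin n → ℝ → ℝ)
    (hf0 : ∀ i, f i 0 = 0) (hf1 : ∀ i, f i 1 = 1) (π : Equiv.Perm (Fin n)) (i : Fin n)
    (x : Fin n → ℝ) :
    ((∑ j, w j * f j (if π j < π i then x j else 1)) -
        (∑ j, w j * f j (if π j < π i then x j else 0))) -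
      ((∑ j, w j * f j (if π j ≤ π i then x j else 1)) -
        (∑ j, w j * f j (if π j ≤ π i then x j else 0))) = w i := by
  simp only [← Finset.sum_sub_distrib]
  rw [Finset.sum_eq_single i]
  · simp [hf0, hf1]
  · intro j _ hj
    have hne : π j ≠ π i := fun h => hj (π.injective h)
    simp [hne.le_iff_lt]
  · simp

/-- A weighted sum `f(x) = Σ_i w_i f_i(x_i)` of monotone functions
`f_i : [0,1] → [0,1]` with `f_i(0) = 0`, `f_i(1) = 1` and nonnegative weights summing to one
is an interval simple game with `Ψ_i(f) = w_i`. -/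
theorem Psi_weighted_sum (n : ℕ) (hn : 1 ≤ n) (w : Fin n → ℝ) (hw0 : ∀ i, 0 ≤ w i)
    (hw1 : ∑ i, w i = 1) (f : Fin n → ℝ → ℝ)
    (hf01 : ∀ i, ∀ t ∈ Set.Icc (0 : ℝ) 1, f i t ∈ Set.Icc (0 : ℝ) 1)
    (hfmono : ∀ i, ∀ s ∈ Set.Icc (0 : ℝ) 1, ∀ t ∈ Set.Icc (0 : ℝ) 1, s ≤ t → f i s ≤ f i t)
    (hf0 : ∀ i, f i 0 = 0) (hf1 : ∀ i, f i 1 = 1) :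
    IsISG n (fun x => ∑ i, w i * f i (x i)) ∧
    ∀ i, Psi n (fun x => ∑ i, w i * f i (x i)) i = w i := by
  refine ⟨⟨by simp [hf0], by simp [hf1, hw1], fun x hx => ⟨?_, ?_⟩, fun x hx y hy hxy => ?_⟩,
    fun i => ?_⟩
  · exact Finset.sum_nonneg fun i _ => mul_nonneg (hw0 i) (hf01 i _ (hx i)).1
  · rw [← hw1]
    exact Finset.sum_le_sum fun i _ => mul_le_of_le_one_right (hw0 i) (hf01 i _ (hx i)).2
  · exact Finset.sum_le_sum fun i _ =>
      mul_le_mul_of_nonneg_left (hfmono i _ (hx i) _ (hy i) (hxy i)) (hw0 i)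
  · have hfac : (n.factorial : ℝ) ≠ 0 := by exact_mod_cast n.factorial_ne_zero
    simp only [Psi, weighted_sum_marginal n w f hf0 hf1, setIntegral_const, volume_real_cube,
      one_smul, Finset.sum_const, Finset.card_univ, Fintype.card_perm, Fintype.card_fin,
      nsmul_eq_mul]
    field_simp
end

section
/- Let n ≥ 1 and let α_1,…,α_n be positive real numbers. Define f : [0,1]^n → [0,1] by f(x) = Π_{i=1}^n x_i^{α_i} and set Λ = Π_{j=1}^n (α_j + 1). Then f is an interval simple game and, for all i ∈ N, Ψ_i(f) = (1/(n!·Λ))·( (n−1)! + α_i·Σ_{T ⊆ N∖{i}} |T|!·(n−1−|T|)!·Π_{j∈T}(α_j + 1) ). -/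
open MeasureTheory

theorem volume_restrict_cube (n : ℕ) :
    (volume : Measure (Fin n → ℝ)).restrict (cube n) =
      Measure.pi fun _ => volume.restrict (Set.Icc (0 : ℝ) 1) := by
  have h : cube n = Set.pi Set.univ fun _ => Set.Icc (0 : ℝ) 1 := by
    ext x; exact ⟨fun h i _ => h i, fun h i => h i trivial⟩
  rw [h, volume_pi, Measure.restrict_pi_pi]

theorem integrable_ite_rpow (p : Prop) [Decidable p] {b : ℝ} (hb : 0 < b) :
    Integrable (fun t : ℝ => (if p then t else 1) ^ b) (volume.restrict (Set.Icc 0 1)) := by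
  have : Continuous fun t : ℝ => (if p then t else 1) ^ b := by
    split_ifs
    · exact Real.continuous_rpow_const hb.le
    · exact continuous_const
  exact this.continuousOn.integrableOn_Icc

theorem integral_ite_rpow (p : Prop) [Decidable p] {b : ℝ} (hb : 0 < b) :
    ∫ t in Set.Icc (0 : ℝ) 1, (if p then t else 1) ^ b = if p then (b + 1)⁻¹ else 1 := by
  split_ifs
  · rw [integral_Icc_eq_integral_Ioc, ← intervalIntegral.integral_of_le zero_le_one,
      integral_rpow (Or.inl (by linarith)), Real.one_rpow, Real.zero_rpow (by linarith)]
    simp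
  · simp

theorem integrable_prod_ite_rpow {n : ℕ} {a : Fin n → ℝ} (ha : ∀ i, 0 < a i)
    (p : Fin n → Prop) [DecidablePred p] :
    IntegrableOn (fun x : Fin n → ℝ => ∏ j, (if p j then x j else 1) ^ a j) (cube n) := by
  rw [IntegrableOn, volume_restrict_cube]
  exact Integrable.fintype_prod fun j => integrable_ite_rpow (p j) (ha j)

theorem integral_prod_ite_rpow {n : ℕ} {a : Fin n → ℝ} (ha : ∀ i, 0 < a i)
    (p : Fin n → Prop) [DecidablePred p] :
    ∫ x in cube n, ∏ j, (if p j then x j else 1) ^ a j =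
      ∏ j, if p j then (a j + 1)⁻¹ else 1 := by
  rw [volume_restrict_cube,
    integral_fintype_prod_eq_prod (fun j t => (if p j then t else 1) ^ a j)]
  exact Finset.prod_congr rfl fun j _ => integral_ite_rpow (p j) (ha j)

/-- The elements placed after `i` by the permutation `π`. -/
def successors {n : ℕ} (π : Equiv.Perm (Fin n)) (i : Fin n) : Finset (Fin n) :=
  Finset.univ.filter fun j => π i < π j

theorem mem_successors {n : ℕ} {π : Equiv.Perm (Fin n)} {i j : Fin n} :
    j ∈ successors π i ↔ π i < π j := by
  simp [successors]

theorem card_successors {n : ℕ} (π : Equiv.Perm (Fin n)) (i : Fin n) :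
    (successors π i).card = n - 1 - π i := by
  rw [← Fin.card_Ioi, ← Finset.card_map π.toEmbedding]
  congr 1
  ext k
  simp only [Finset.mem_map_equiv, mem_successors, Equiv.apply_symm_apply, Finset.mem_Ioi]

theorem exists_successors_eq {n : ℕ} (i : Fin n) (T : Finset (Fin n)) (hi : i ∉ T) :
    ∃ π : Equiv.Perm (Fin n), successors π i = T := by
  have hS : ∃ e : Equiv.Perm (Fin n), ∀ j, j ∈ T ↔ e j < T.card := by
    have hpos : 0 < (Numbering.prefixed T).card := by
      rw [Numbering.card_prefixed]; positivity
    obtain ⟨e, he⟩ := Finset.card_pos.1 hpos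
    rw [Numbering.mem_prefixed] at he
    exact ⟨e.trans (finCongr (Fintype.card_fin n)), fun j => by simpa using he j⟩
  obtain ⟨e, he⟩ := hS
  have hcard : T.card < n := by
    have := (he i).not.1 hi
    have := (e i).isLt
    omega
  refine ⟨(e.trans (Equiv.swap (e i) ⟨T.card, hcard⟩)).trans Fin.revPerm, ?_⟩
  ext j
  rw [mem_successors, he]
  simp only [Equiv.trans_apply, Equiv.swap_apply_left, Fin.revPerm_apply, Fin.rev_lt_rev]
  have hi' := (he i).not.1 hi
  rw [Equiv.swap_apply_def]
  split_ifs with h1 h2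
  · simp [h1]; omega
  · rw [h2, Fin.lt_def]; simp; omega
  · rw [Fin.lt_def]

theorem card_successors_eq {n : ℕ} (i : Fin n) (T : Finset (Fin n)) (hi : i ∉ T) :
    (Finset.univ.filter fun π : Equiv.Perm (Fin n) => successors π i = T).card =
      T.card.factorial * (n - 1 - T.card).factorial := by
  obtain ⟨π₀, h₀⟩ := exists_successors_eq i T hi
  let f : Fin n → Fin 3 := fun j => if j = i then 0 else if j ∈ T then 1 else 2
  have f0 (j) : f j = 0 ↔ j = i := by simp only [f]; split_ifs <;> simp_all
  have f1 (j) : f j = 1 ↔ j ∈ T := by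
    simp only [f]; split_ifs with h <;> simp_all
  have key (σ : Equiv.Perm (Fin n)) : f ∘ σ = f ↔ successors (π₀ * σ) i = T := by
    constructor
    · intro h
      have hσ (j) : f (σ j) = f j := congrFun h j
      have hσi : σ i = i := by rw [← f0, hσ, f0]
      ext j
      rw [mem_successors, Equiv.Perm.mul_apply, Equiv.Perm.mul_apply, hσi, ← mem_successors, h₀,
        ← f1, hσ, f1]
    · intro h
      have hσi : σ i = i := by
        have h1 := card_successors (π₀ * σ) i
        have h2 := card_successors π₀ i
        rw [h] at h1
        rw [h₀] at h2
        have h3 := ((π₀ * σ) i).isLt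
        have h4 := (π₀ i).isLt
        apply π₀.injective
        rw [Fin.ext_iff, ← Equiv.Perm.mul_apply]
        omega
      have hT (j) : σ j ∈ T ↔ j ∈ T := by
        rw [← h₀, mem_successors, h₀, ← h, mem_successors, Equiv.Perm.mul_apply,
          Equiv.Perm.mul_apply, hσi]
      have hI (j) : σ j = i ↔ j = i := by
        constructor
        · intro hj; exact σ.injective (hj.trans hσi.symm)
        · rintro rfl; exact hσi
      funext j
      simp only [f, Function.comp_apply, hT, hI]
  have hcard := DomMulAct.stabilizer_card f
  rw [Fintype.card_subtype, Fin.prod_univ_three] at hcard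
  have e0 : Fintype.card {j // f j = 0} = 1 := by
    rw [Fintype.card_subtype]; simp [f0, Finset.filter_eq']
  have e1 : Fintype.card {j // f j = 1} = T.card := by
    rw [Fintype.card_subtype]; simp [f1]
  have e2 : Fintype.card {j // f j = 2} = n - 1 - T.card := by
    have : (Finset.univ.filter fun j => f j = 2) = (insert i T)ᶜ := by
      ext j
      simp only [f, Finset.mem_filter, Finset.mem_univ, true_and, Finset.mem_compl,
        Finset.mem_insert]
      split_ifs <;> simp_all
    rw [Fintype.card_subtype, this, Finset.card_compl, Finset.card_insert_of_notMem hi,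
      Fintype.card_fin]
    omega
  rw [e0, e1, e2, Nat.factorial_one, one_mul] at hcard
  rw [← hcard]
  refine (Finset.card_equiv (Equiv.mulLeft π₀) fun σ => ?_).symm
  simp [key]

theorem sum_successors {n : ℕ} (i : Fin n) (F : Finset (Fin n) → ℝ) :
    ∑ π : Equiv.Perm (Fin n), F (successors π i) =
      ∑ T ∈ (Finset.univ.erase i).powerset,
        (T.card.factorial : ℝ) * ((n - 1 - T.card).factorial : ℝ) * F T := by
  rw [← Finset.sum_fiberwise_of_maps_to' (t := (Finset.univ.erase i).powerset)
    (g := fun π => successors π i)]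
  · refine Finset.sum_congr rfl fun T hT => ?_
    have hi : i ∉ T := fun h => by simpa using Finset.mem_powerset.1 hT h
    rw [Finset.sum_const, card_successors_eq i T hi, nsmul_eq_mul, Nat.cast_mul]
  · intro π _
    rw [Finset.mem_powerset]
    intro j hj
    rw [mem_successors] at hj
    simp only [Finset.mem_erase, Finset.mem_univ, and_true]
    rintro rfl
    exact lt_irrefl _ hj

theorem isISG_prod_rpow {n : ℕ} (hn : 1 ≤ n) {a : Fin n → ℝ} (ha : ∀ i, 0 < a i) :
    IsISG n fun x => ∏ i, x i ^ a i := by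
  refine ⟨?_, by simp, fun x hx => ⟨?_, ?_⟩, fun x hx y _ hxy => ?_⟩
  · exact Finset.prod_eq_zero (Finset.mem_univ ⟨0, hn⟩) (Real.zero_rpow (ha _).ne')
  · exact Finset.prod_nonneg fun j _ => Real.rpow_nonneg (hx j).1 _
  · exact Finset.prod_le_one (fun j _ => Real.rpow_nonneg (hx j).1 _)
      fun j _ => Real.rpow_le_one (hx j).1 (hx j).2 (ha j).le
  · exact Finset.prod_le_prod (fun j _ => Real.rpow_nonneg (hx j).1 _)
      fun j _ => Real.rpow_le_rpow (hx j).1 (hxy j) (ha j).le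

theorem prod_ite_inv {n : ℕ} {a : Fin n → ℝ} (ha : ∀ i, 0 < a i) (p : Fin n → Prop)
    [DecidablePred p] (T : Finset (Fin n)) (hT : ∀ j, j ∈ T ↔ ¬ p j) :
    (∏ j, if p j then (a j + 1)⁻¹ else 1) = (∏ j ∈ T, (a j + 1)) / ∏ j, (a j + 1) := by
  have hT' : T = Finset.univ.filter fun j => ¬ p j := by ext j; simp [hT]
  have hne (j) : a j + 1 ≠ 0 := by linarith [ha j]
  rw [eq_div_iff (Finset.prod_ne_zero_iff.2 fun j _ => hne j), ← Finset.prod_mul_distrib, hT',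
    Finset.prod_filter]
  refine Finset.prod_congr rfl fun j _ => ?_
  by_cases h : p j <;> simp [h, hne j]

theorem integral_marginal_prod_rpow {n : ℕ} {a : Fin n → ℝ} (ha : ∀ i, 0 < a i)
    (π : Equiv.Perm (Fin n)) (i : Fin n) :
    ∫ x in cube n,
      ((∏ j, (if π j < π i then x j else 1) ^ a j - ∏ j, (if π j < π i then x j else 0) ^ a j) -
        (∏ j, (if π j ≤ π i then x j else 1) ^ a j -
          ∏ j, (if π j ≤ π i then x j else 0) ^ a j)) =
      (a i * ∏ j ∈ successors π i, (a j + 1) + if successors π i = ∅ then 1 else 0) /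
        ∏ j, (a j + 1) := by
  have hzero (x : Fin n → ℝ) : ∏ j, (if π j < π i then x j else 0) ^ a j = 0 :=
    Finset.prod_eq_zero (Finset.mem_univ i) (by simp [Real.zero_rpow (ha i).ne'])
  have hlast (x : Fin n → ℝ) : ∏ j, (if π j ≤ π i then x j else 0) ^ a j =
      (if successors π i = ∅ then 1 else 0) * ∏ j, (if π j ≤ π i then x j else 1) ^ a j := by
    split_ifs with h
    · have hle (j) : π j ≤ π i := not_lt.1 fun hj => by
        simpa [h] using mem_successors.2 hj
      simp [hle]
    · obtain ⟨j, hj⟩ := Finset.nonempty_iff_ne_empty.2 h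
      rw [zero_mul]
      refine Finset.prod_eq_zero (Finset.mem_univ j) ?_
      rw [if_neg (not_le.2 (mem_successors.1 hj)), Real.zero_rpow (ha j).ne']
  have hlt := integrable_prod_ite_rpow ha fun j => π j < π i
  have hle := integrable_prod_ite_rpow ha fun j => π j ≤ π i
  have hi : i ∉ successors π i := fun h => lt_irrefl _ (mem_successors.1 h)
  simp_rw [hzero, hlast, sub_zero]
  rw [integral_sub hlt (by exact hle.sub (hle.const_mul _)), integral_sub hle (hle.const_mul _),
    integral_const_mul, integral_prod_ite_rpow ha, integral_prod_ite_rpow ha,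
    prod_ite_inv ha (fun j => π j < π i) (insert i (successors π i)) fun j => by
      rw [Finset.mem_insert, mem_successors, not_lt, le_iff_eq_or_lt, π.injective.eq_iff, eq_comm],
    prod_ite_inv ha (fun j => π j ≤ π i) (successors π i) fun j => by rw [mem_successors, not_le],
    Finset.prod_insert hi]
  split_ifs with h
  · rw [h, Finset.prod_empty]; ring
  · ring

/-- For positive reals `α_1,…,α_n`, the product game `f(x) = Π_i x_i^{α_i}`
is an interval simple game and its Shapley–Shubik index is given by the stated formula. -/
theorem Psi_product_game (n : ℕ) (hn : 1 ≤ n) (a : Fin n → ℝ) (ha : ∀ i, 0 < a i) :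
    IsISG n (fun x => ∏ i, (x i) ^ (a i)) ∧
    ∀ i : Fin n,
      Psi n (fun x => ∏ i, (x i) ^ (a i)) i =
        (1 / ((n.factorial : ℝ) * ∏ j, (a j + 1))) *
          (((n - 1).factorial : ℝ) +
            a i * ∑ T ∈ (Finset.univ.erase i).powerset,
              (T.card.factorial : ℝ) * ((n - 1 - T.card).factorial : ℝ) *
                ∏ j ∈ T, (a j + 1)) := by
  refine ⟨isISG_prod_rpow hn ha, fun i => ?_⟩
  simp only [Psi, integral_marginal_prod_rpow ha]
  rw [sum_successors i fun T =>
    (a i * ∏ j ∈ T, (a j + 1) + if T = ∅ then 1 else 0) / ∏ j, (a j + 1)]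
  simp_rw [← mul_div_assoc, ← Finset.sum_div, mul_add, Finset.sum_add_distrib, mul_ite, mul_one,
    mul_zero, Finset.sum_ite_eq']
  simp only [Finset.empty_mem_powerset, if_true, Finset.card_empty, Nat.factorial_zero,
    Nat.cast_one, one_mul, Nat.sub_zero]
  rw [Finset.sum_congr rfl fun T _ => mul_left_comm _ (a i) _, ← Finset.mul_sum]
  ring
end

section
/- For every α ∈ [0,1], the power index Ψ^a with a = (α,…,α) ∈ [0,1]^n is positive, efficient, anonymous, symmetric, and satisfies both the null player property and the transfer property on interval simple games. -/
open MeasureTheory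

/-- The point-evaluation variant `Ψ^a` of the Shapley–Shubik index, where `a = (α,…,α)`. -/
noncomputable def PsiA (n : ℕ) (α : ℝ) (v : (Fin n → ℝ) → ℝ) (i : Fin n) : ℝ :=
  (1 / (n.factorial : ℝ)) * ∑ π : Equiv.Perm (Fin n),
    ((v (fun j => if π j < π i then α else 1) -
      v (fun j => if π j < π i then α else 0)) -
     (v (fun j => if π j ≤ π i then α else 1) -
      v (fun j => if π j ≤ π i then α else 0)))

section PsiALemmas

variable {n : ℕ} {α : ℝ} {v : (Fin n → ℝ) → ℝ}

theorem ite_mem_cube (p : Fin n → Prop) [DecidablePred p] {a b : ℝ}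
    (ha : a ∈ Set.Icc (0 : ℝ) 1) (hb : b ∈ Set.Icc (0 : ℝ) 1) :
    (fun j => if p j then a else b) ∈ cube n := by
  intro j
  dsimp only
  split_ifs <;> assumption

theorem zero_mem_unit : (0 : ℝ) ∈ Set.Icc (0 : ℝ) 1 := ⟨le_rfl, zero_le_one⟩

theorem one_mem_unit : (1 : ℝ) ∈ Set.Icc (0 : ℝ) 1 := ⟨zero_le_one, le_rfl⟩

/-- The value of `PsiA` at a player depends only on the restriction of the game to the cube. -/
theorem PsiA_congr (hα : α ∈ Set.Icc (0 : ℝ) 1) {u : (Fin n → ℝ) → ℝ}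
    (h : ∀ x ∈ cube n, u x = v x) (i : Fin n) : PsiA n α u i = PsiA n α v i := by
  unfold PsiA
  congr 1
  refine Finset.sum_congr rfl fun π _ => ?_
  rw [h _ (ite_mem_cube _ hα one_mem_unit), h _ (ite_mem_cube _ hα zero_mem_unit),
    h _ (ite_mem_cube _ hα one_mem_unit), h _ (ite_mem_cube _ hα zero_mem_unit)]

theorem PsiA_comp_perm (π : Equiv.Perm (Fin n)) (i : Fin n) :
    PsiA n α (fun x => v (fun j => x (π j))) (π i) = PsiA n α v i := by
  unfold PsiA
  congr 1
  exact Fintype.sum_equiv (Equiv.mulRight π) _ _ fun _ => rfl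

theorem PsiA_nonneg (hα : α ∈ Set.Icc (0 : ℝ) 1) (hv : IsISG n v) (i : Fin n) :
    0 ≤ PsiA n α v i := by
  unfold PsiA
  refine mul_nonneg (by positivity) (Finset.sum_nonneg fun π _ => ?_)
  have mono := hv.2.2.2
  have h1 := mono _ (ite_mem_cube (fun j => π j ≤ π i) hα one_mem_unit)
    _ (ite_mem_cube (fun j => π j < π i) hα one_mem_unit) fun j => by
      split_ifs with h h'
      · rfl
      · exact hα.2
      · exact absurd (le_of_lt ‹_›) h
      · rfl
  have h0 := mono _ (ite_mem_cube (fun j => π j < π i) hα zero_mem_unit)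
    _ (ite_mem_cube (fun j => π j ≤ π i) hα zero_mem_unit) fun j => by
      split_ifs with h h'
      · rfl
      · exact absurd (le_of_lt h) h'
      · exact hα.1
      · rfl
  linarith

theorem sum_PsiA (hv : IsISG n v) : ∑ i, PsiA n α v i = 1 := by
  unfold PsiA
  rw [← Finset.mul_sum, Finset.sum_comm]
  have telescope : ∀ π : Equiv.Perm (Fin n), ∑ i,
      ((v (fun j => if π j < π i then α else 1) - v (fun j => if π j < π i then α else 0)) -
        (v (fun j => if π j ≤ π i then α else 1) -
          v (fun j => if π j ≤ π i then α else 0))) = 1 := by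
    intro π
    let f : ℕ → ℝ := fun k =>
      v (fun j => if (π j : ℕ) < k then α else 1) - v (fun j => if (π j : ℕ) < k then α else 0)
    calc _ = ∑ i, (f (π i) - f (π i + 1)) := by
          simp only [f, Fin.lt_def, Fin.le_def, Nat.lt_succ_iff]
      _ = ∑ i : Fin n, (f i - f (i + 1)) := Equiv.sum_comp π fun i : Fin n => f i - f (i + 1)
      _ = f 0 - f n := by
          rw [Fin.sum_univ_eq_sum_range fun k => f k - f (k + 1), Finset.sum_range_sub']
      _ = 1 := by simp [f, hv.1, hv.2.1]
  rw [Finset.sum_congr rfl fun π _ => telescope π]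
  simp [Fintype.card_perm, Nat.factorial_ne_zero]

theorem PsiA_eq_of_symPlayers (hα : α ∈ Set.Icc (0 : ℝ) 1) {i j : Fin n}
    (h : SymPlayers n v i j) : PsiA n α v i = PsiA n α v j := by
  rw [← PsiA_comp_perm (Equiv.swap i j) i, Equiv.swap_apply_left]
  exact PsiA_congr hα h j

theorem PsiA_eq_zero_of_nullPlayer (hα : α ∈ Set.Icc (0 : ℝ) 1) {i : Fin n}
    (h : NullPlayer n v i) : PsiA n α v i = 0 := by
  unfold PsiA
  rw [Finset.sum_eq_zero, mul_zero]
  intro π _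
  have key : ∀ b ∈ Set.Icc (0 : ℝ) 1, v (fun j => if π j < π i then α else b) =
      v (fun j => if π j ≤ π i then α else b) := fun b hb =>
    h _ (ite_mem_cube _ hα hb) _ (ite_mem_cube _ hα hb) fun j hj => by
      simp only [le_iff_lt_or_eq, π.injective.eq_iff, hj, or_false]
  rw [key 1 one_mem_unit, key 0 zero_mem_unit, sub_self]

theorem PsiA_add_eq_sup_add_inf (u v : (Fin n → ℝ) → ℝ) (i : Fin n) :
    PsiA n α u i + PsiA n α v i =
      PsiA n α (fun x => max (u x) (v x)) i + PsiA n α (fun x => min (u x) (v x)) i := by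
  unfold PsiA
  rw [← mul_add, ← mul_add, ← Finset.sum_add_distrib, ← Finset.sum_add_distrib]
  congr 1
  refine Finset.sum_congr rfl fun π _ => ?_
  have h := fun x => max_add_min (u x) (v x)
  linarith [h fun j => if π j < π i then α else 1, h fun j => if π j < π i then α else 0,
    h fun j => if π j ≤ π i then α else 1, h fun j => if π j ≤ π i then α else 0]

end PsiALemmas

/-- For every `α ∈ [0,1]`, the power index `Ψ^a` with `a = (α,…,α)` is
positive, efficient, anonymous, symmetric, and satisfies both the null player property and
the transfer property on interval simple games. -/
theorem PsiA_properties (n : ℕ) (hn : 1 ≤ n) (α : ℝ) (hα : α ∈ Set.Icc (0 : ℝ) 1) :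
    Positive n (PsiA n α) ∧ Efficient n (PsiA n α) ∧ Anonymous n (PsiA n α) ∧
    SymmetricIdx n (PsiA n α) ∧ NullPlayerProp n (PsiA n α) ∧ Transfer n (PsiA n α) := by
  refine ⟨fun v hv => ⟨fun h => ?_, PsiA_nonneg hα hv⟩, fun v hv => sum_PsiA hv,
    fun v _ π i => PsiA_comp_perm π i, fun v _ i j h => PsiA_eq_of_symPlayers hα h,
    fun v _ i h => PsiA_eq_zero_of_nullPlayer hα h,
    fun u v _ _ i => PsiA_add_eq_sup_add_inf u v i⟩
  have hsum := sum_PsiA (α := α) hv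
  simp [h] at hsum
end

section
/- Let n ≥ 2 and let v : [0,1]^n → [0,1] be defined by v(x) = x_1·x_2^2. Then v is an interval simple game with Ψ(v) = (5/12, 7/12, 0, …, 0), while for every α ∈ [0,1] and a = (α,…,α) one has Ψ^a(v) = (1/2 − (α−α^2)/2, 1/2 + (α−α^2)/2, 0, …, 0); in particular Ψ(v) ≠ Ψ^a(v) whenever α ∉ {1/2 + 1/(2√3), 1/2 − 1/(2√3)}. -/
open MeasureTheory

/-- The marginal contribution of player `i` under the order `π` at the profile `x`. -/
def marginal {n : ℕ} (v : (Fin n → ℝ) → ℝ) (π : Equiv.Perm (Fin n)) (i : Fin n)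
    (x : Fin n → ℝ) : ℝ :=
  (v (fun j => if π j < π i then x j else 1) -
    v (fun j => if π j < π i then x j else 0)) -
   (v (fun j => if π j ≤ π i then x j else 1) -
    v (fun j => if π j ≤ π i then x j else 0))

lemma Psi_eq_sum_marginal {n : ℕ} (v : (Fin n → ℝ) → ℝ) (i : Fin n) :
    Psi n v i = (1 / (n.factorial : ℝ)) * ∑ π : Equiv.Perm (Fin n),
      ∫ x in cube n, marginal v π i x := rfl

lemma PsiA_eq_sum_marginal {n : ℕ} (α : ℝ) (v : (Fin n → ℝ) → ℝ) (i : Fin n) :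
    PsiA n α v i = (1 / (n.factorial : ℝ)) * ∑ π : Equiv.Perm (Fin n),
      marginal v π i (fun _ => α) := rfl

lemma marginal_left {n : ℕ} {a b : Fin n} (hab : a ≠ b) (π : Equiv.Perm (Fin n))
    (x : Fin n → ℝ) :
    marginal (fun x => x a * x b ^ 2) π a x = if π a < π b then 1 - x a else x b ^ 2 := by
  rcases lt_or_gt_of_ne (π.injective.ne hab) with h | h
  · simp [marginal, h, h.not_gt, h.not_ge]
  · simp [marginal, h, h.not_gt, h.le]

lemma marginal_right {n : ℕ} {a b : Fin n} (hab : a ≠ b) (π : Equiv.Perm (Fin n))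
    (x : Fin n → ℝ) :
    marginal (fun x => x a * x b ^ 2) π b x = if π a < π b then x a else 1 - x b ^ 2 := by
  rcases lt_or_gt_of_ne (π.injective.ne hab) with h | h
  · simp [marginal, h, h.le]
  · simp [marginal, h.not_gt, h.not_ge]

lemma marginal_other {n : ℕ} {a b i : Fin n} (ha : a ≠ i) (hb : b ≠ i)
    (π : Equiv.Perm (Fin n)) (x : Fin n → ℝ) :
    marginal (fun x => x a * x b ^ 2) π i x = 0 := by
  simp [marginal, (π.injective.ne ha).le_iff_lt, (π.injective.ne hb).le_iff_lt]

/-- Exactly half of all orders place `a` before `b`. -/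
lemma average_perm_lt {n : ℕ} {a b : Fin n} (hab : a ≠ b) (A B : ℝ) :
    (1 / (n.factorial : ℝ)) * ∑ π : Equiv.Perm (Fin n), (if π a < π b then A else B) =
      (A + B) / 2 := by
  have hswap : ∑ π : Equiv.Perm (Fin n), (if π a < π b then A else B) =
      ∑ π : Equiv.Perm (Fin n), (if π b < π a then A else B) := by
    rw [← Equiv.sum_comp (Equiv.mulRight (Equiv.swap a b))]
    simp
  have hsum : ∑ π : Equiv.Perm (Fin n), (if π a < π b then A else B) +
      ∑ π : Equiv.Perm (Fin n), (if π b < π a then A else B) = n.factorial * (A + B) := by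
    rw [← Finset.sum_add_distrib, Finset.sum_congr rfl (g := fun _ => A + B)]
    · simp [Fintype.card_perm, mul_add]
    · intro π _
      rcases lt_or_gt_of_ne (π.injective.ne hab) with h | h
      · simp [h, h.not_gt]
      · simp [h, h.not_gt, add_comm]
  have hn : (n.factorial : ℝ) ≠ 0 := by positivity
  field_simp
  linarith

lemma setIntegral_cube_eval {n : ℕ} (k : Fin n) {f : ℝ → ℝ} (hf : Continuous f) :
    ∫ x in cube n, f (x k) = ∫ t in (0 : ℝ)..1, f t := by
  have hcube : cube n = Set.univ.pi (fun _ => Set.Icc (0 : ℝ) 1) := by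
    ext x
    simp only [cube, Set.mem_ofPred_eq, Set.mem_univ_pi]
  have : IsProbabilityMeasure (volume.restrict (Set.Icc (0 : ℝ) 1)) := ⟨by simp⟩
  have hmp := measurePreserving_eval
    (fun _ : Fin n => volume.restrict (Set.Icc (0 : ℝ) 1)) k
  rw [hcube, volume_pi, Measure.restrict_pi_pi, intervalIntegral.integral_of_le zero_le_one,
    ← integral_Icc_eq_integral_Ioc]
  have hmap := integral_map (μ := Measure.pi fun _ : Fin n => volume.restrict (Set.Icc (0 : ℝ) 1))
    (f := f) hmp.measurable.aemeasurable hf.aestronglyMeasurable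
  rw [hmp.map_eq] at hmap
  exact hmap.symm

lemma isISG_mul_sq {n : ℕ} (a b : Fin n) : IsISG n (fun x => x a * x b ^ 2) := by
  refine ⟨by simp, by simp, fun x hx => ⟨?_, ?_⟩, fun x hx y hy hxy => ?_⟩
  · exact mul_nonneg (hx a).1 (sq_nonneg _)
  · exact mul_le_one₀ (hx a).2 (sq_nonneg _) (pow_le_one₀ (hx b).1 (hx b).2)
  · exact mul_le_mul (hxy a) (pow_le_pow_left₀ (hx b).1 (hxy b) 2) (sq_nonneg _) (hy a).1

lemma Psi_left {n : ℕ} {a b : Fin n} (hab : a ≠ b) :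
    Psi n (fun x => x a * x b ^ 2) a = 5 / 12 := by
  have h1 : ∫ x in cube n, (1 - x a) = 1 / 2 := by
    rw [setIntegral_cube_eval a (f := fun t => 1 - t) (by fun_prop),
      intervalIntegral.integral_sub (by simp) (by simp)]
    norm_num
  have h2 : ∫ x in cube n, x b ^ 2 = 1 / 3 := by
    rw [setIntegral_cube_eval b (f := fun t => t ^ 2) (by fun_prop)]
    norm_num
  have h (π : Equiv.Perm (Fin n)) :
      ∫ x in cube n, marginal (fun x => x a * x b ^ 2) π a x =
        if π a < π b then 1 / 2 else 1 / 3 := by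
    simp only [marginal_left hab]
    split_ifs <;> assumption
  simp only [Psi_eq_sum_marginal, h, average_perm_lt hab]
  norm_num

lemma Psi_right {n : ℕ} {a b : Fin n} (hab : a ≠ b) :
    Psi n (fun x => x a * x b ^ 2) b = 7 / 12 := by
  have h1 : ∫ x in cube n, x a = 1 / 2 := by
    rw [setIntegral_cube_eval a (f := fun t => t) (by fun_prop)]
    norm_num
  have h2 : ∫ x in cube n, (1 - x b ^ 2) = 2 / 3 := by
    rw [setIntegral_cube_eval b (f := fun t => 1 - t ^ 2) (by fun_prop),
      intervalIntegral.integral_sub (by simp) (by simp)]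
    norm_num
  have h (π : Equiv.Perm (Fin n)) :
      ∫ x in cube n, marginal (fun x => x a * x b ^ 2) π b x =
        if π a < π b then 1 / 2 else 2 / 3 := by
    simp only [marginal_right hab]
    split_ifs <;> assumption
  simp only [Psi_eq_sum_marginal, h, average_perm_lt hab]
  norm_num

lemma PsiA_left {n : ℕ} {a b : Fin n} (hab : a ≠ b) (α : ℝ) :
    PsiA n α (fun x => x a * x b ^ 2) a = 1 / 2 - (α - α ^ 2) / 2 := by
  simp only [PsiA_eq_sum_marginal, marginal_left hab, average_perm_lt hab]
  ring

lemma PsiA_right {n : ℕ} {a b : Fin n} (hab : a ≠ b) (α : ℝ) :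
    PsiA n α (fun x => x a * x b ^ 2) b = 1 / 2 + (α - α ^ 2) / 2 := by
  simp only [PsiA_eq_sum_marginal, marginal_right hab, average_perm_lt hab]
  ring

lemma eq_half_add_or_sub_of_quadratic {α : ℝ}
    (h : (5 : ℝ) / 12 = 1 / 2 - (α - α ^ 2) / 2) :
    α = 1 / 2 + 1 / (2 * Real.sqrt 3) ∨ α = 1 / 2 - 1 / (2 * Real.sqrt 3) := by
  have hs : (1 / (2 * Real.sqrt 3)) ^ 2 = 1 / 12 := by
    rw [div_pow, mul_pow, Real.sq_sqrt (by norm_num)]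
    norm_num
  have hsq : (α - 1 / 2) ^ 2 = (1 / (2 * Real.sqrt 3)) ^ 2 := by
    rw [hs]
    linarith
  rcases sq_eq_sq_iff_eq_or_eq_neg.mp hsq with h | h
  · left; linarith
  · right; linarith

/-- For `n ≥ 2` and `v(x) = x_1·x_2²`: `v` is an interval simple game with
`Ψ(v) = (5/12, 7/12, 0, …, 0)` and `Ψ^a(v) = (1/2 − (α−α²)/2, 1/2 + (α−α²)/2, 0, …, 0)`;
in particular `Ψ(v) ≠ Ψ^a(v)` whenever `α ∉ {1/2 + 1/(2√3), 1/2 − 1/(2√3)}`. -/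
theorem Psi_ne_PsiA_example (n : ℕ) (hn : 2 ≤ n) (α : ℝ) (hα : α ∈ Set.Icc (0 : ℝ) 1)
    (v : (Fin n → ℝ) → ℝ)
    (hv : v = fun x => x ⟨0, by omega⟩ * (x ⟨1, by omega⟩) ^ 2) :
    IsISG n v ∧
    Psi n v ⟨0, by omega⟩ = 5 / 12 ∧
    Psi n v ⟨1, by omega⟩ = 7 / 12 ∧
    (∀ i : Fin n, 2 ≤ (i : ℕ) → Psi n v i = 0) ∧
    PsiA n α v ⟨0, by omega⟩ = 1 / 2 - (α - α ^ 2) / 2 ∧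
    PsiA n α v ⟨1, by omega⟩ = 1 / 2 + (α - α ^ 2) / 2 ∧
    (∀ i : Fin n, 2 ≤ (i : ℕ) → PsiA n α v i = 0) ∧
    (α ≠ 1 / 2 + 1 / (2 * Real.sqrt 3) → α ≠ 1 / 2 - 1 / (2 * Real.sqrt 3) →
      Psi n v ≠ PsiA n α v) := by
  have hab : (⟨0, by omega⟩ : Fin n) ≠ ⟨1, by omega⟩ := by simp
  have hne (i : Fin n) (hi : 2 ≤ (i : ℕ)) :
      (⟨0, by omega⟩ : Fin n) ≠ i ∧ (⟨1, by omega⟩ : Fin n) ≠ i := by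
    constructor <;> simp only [ne_eq, Fin.ext_iff] <;> omega
  subst hv
  refine ⟨isISG_mul_sq _ _, Psi_left hab, Psi_right hab, fun i hi => ?_, PsiA_left hab α,
    PsiA_right hab α, fun i hi => ?_, fun h1 h2 h => ?_⟩
  · simp [Psi_eq_sum_marginal, marginal_other (hne i hi).1 (hne i hi).2]
  · simp [PsiA_eq_sum_marginal, marginal_other (hne i hi).1 (hne i hi).2]
  · have h0 := congrFun h ⟨0, by omega⟩
    rw [Psi_left hab, PsiA_left hab] at h0
    exact (eq_half_add_or_sub_of_quadratic h0).elim h1 h2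
end

section
/- Let j, k ≥ 2 be integers and let v be a (j,k) simple game on n players. Let α = (0, 1/j, 2/j, …, (j−1)/j, 1) and let v̂ be the regular step function with discretization α determined by v̂(x) = v(ē − (1/2,…,1/2))/(k−1) for all x ∈ (α)_{ē} and all ē ∈ Ā_j (the natural embedding of v). Then v̂ is an interval simple game and SSI_i(v) = Ψ_i(v̂) for all i ∈ N. -/
open MeasureTheory

/-- A discretization `0 = α_0 < α_1 < … < α_p = 1` (encoded as a function `ℕ → ℝ`,
only the values `α_0,…,α_p` being relevant). -/
def IsDiscretization (p : ℕ) (α : ℕ → ℝ) : Prop :=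
  1 ≤ p ∧ α 0 = 0 ∧ α p = 1 ∧ ∀ i < p, α i < α (i + 1)

/-- Half-integer indices `e ∈ A_p` are encoded as `e : Fin n → ℕ`, where the value `k`
stands for `k/2`; so even entries are integers and odd entries are half-integers.
`(α)_e` is the corresponding (partially open) box: coordinate `j` equals `α_{e_j}`
if `e_j` is an integer, and ranges in `(α_{e_j − 1/2}, α_{e_j + 1/2})` otherwise. -/
def openBox (n : ℕ) (α : ℕ → ℝ) (e : Fin n → ℕ) : Set (Fin n → ℝ) :=
  {x | ∀ j, if e j % 2 = 0 then x j = α (e j / 2)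
            else α (e j / 2) < x j ∧ x j < α (e j / 2 + 1)}

/-- The closed box `[α]_e`, the closure of `(α)_e`. -/
def closedBox (n : ℕ) (α : ℕ → ℝ) (e : Fin n → ℕ) : Set (Fin n → ℝ) :=
  {x | ∀ j, α (e j / 2) ≤ x j ∧ x j ≤ α ((e j + 1) / 2)}

/-- A step function with discretization `α ∈ D_p`: constant on `(α)_e` for every `e ∈ A_p`. -/
def IsStepFun (n p : ℕ) (α : ℕ → ℝ) (f : (Fin n → ℝ) → ℝ) : Prop :=
  ∀ e : Fin n → ℕ, (∀ j, e j ≤ 2 * p) →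
    ∀ x ∈ openBox n α e, ∀ y ∈ openBox n α e, f x = f y

/-- The element of `Ā_p` (all entries half-integers) encoded by `eb : Fin n → Fin p`:
entry `j` is the half-integer `eb_j + 1/2`, i.e. code `2·eb_j + 1`. -/
def fullIdx {n p : ℕ} (eb : Fin n → Fin p) : Fin n → ℕ := fun j => 2 * (eb j : ℕ) + 1

/-- The center `c_e` of the closed box `[α]_e`. -/
noncomputable def center (n : ℕ) (α : ℕ → ℝ) (e : Fin n → ℕ) : Fin n → ℝ :=
  fun j => (α (e j / 2) + α ((e j + 1) / 2)) / 2

open Classical in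
/-- `E(x)`: the set of full-dimensional boxes `eb ∈ Ā_p` with `x ∈ [α]_{eb}`. -/
noncomputable def Ecal (n p : ℕ) (α : ℕ → ℝ) (x : Fin n → ℝ) : Finset (Fin n → Fin p) :=
  Finset.univ.filter fun eb => x ∈ closedBox n α (fullIdx eb)

open Classical in
/-- A regular step function. -/
noncomputable def RegularStep (n p : ℕ) (α : ℕ → ℝ) (f : (Fin n → ℝ) → ℝ) : Prop :=
  IsStepFun n p α f ∧ f (fun _ => 0) = 0 ∧ f (fun _ => 1) = 1 ∧
  ∀ x ∈ cube n, x ≠ (fun _ => (0 : ℝ)) → x ≠ (fun _ => (1 : ℝ)) →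
    f x = (∑ eb ∈ Ecal n p α x, f (center n α (fullIdx eb))) / ((Ecal n p α x).card : ℝ)

open Classical in
/-- A semi-regular step function. -/
noncomputable def SemiRegularStep (n p : ℕ) (α : ℕ → ℝ) (f : (Fin n → ℝ) → ℝ) : Prop :=
  IsStepFun n p α f ∧
  ∀ x : Fin n → ℝ, (∀ j, 0 < x j ∧ x j < 1) →
    f x = (∑ eb ∈ Ecal n p α x, f (center n α (fullIdx eb))) / ((Ecal n p α x).card : ℝ)
/-- A `(j,k)` simple game on `n` players: a monotone map `{0,…,j−1}^n → {0,…,k−1}`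
with `v(0,…,0) = 0` and `v(j−1,…,j−1) = k−1`. -/
def IsJKGame (n j k : ℕ) (v : (Fin n → ℕ) → ℕ) : Prop :=
  v (fun _ => 0) = 0 ∧ v (fun _ => j - 1) = k - 1 ∧
  (∀ x : Fin n → ℕ, (∀ i, x i ≤ j - 1) → v x ≤ k - 1) ∧
  (∀ x y : Fin n → ℕ, (∀ i, y i ≤ j - 1) → (∀ i, x i ≤ y i) → v x ≤ v y)

/-- `C(v,T)` for a `(j,k)` simple game. -/
noncomputable def jkC (n j k : ℕ) (v : (Fin n → ℕ) → ℕ) (T : Finset (Fin n)) : ℝ :=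
  (1 / ((j : ℝ) ^ n * ((k : ℝ) - 1))) *
    ∑ x : Fin n → Fin j,
      ((v (fun i => if i ∈ T then j - 1 else (x i : ℕ)) : ℝ) -
       (v (fun i => if i ∈ T then 0 else (x i : ℕ)) : ℝ))

/-- The Shapley–Shubik index of a `(j,k)` simple game. -/
noncomputable def jkSSI (n j k : ℕ) (v : (Fin n → ℕ) → ℕ) (i : Fin n) : ℝ :=
  ∑ S ∈ Finset.univ.powerset.filter (fun S : Finset (Fin n) => i ∈ S),
    (((S.card - 1).factorial * (n - S.card).factorial : ℕ) : ℝ) / (n.factorial : ℝ) *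
      (jkC n j k v S - jkC n j k v (S.erase i))
/-- The discretization `α = (0, 1/j, 2/j, …, (j−1)/j, 1)` used for the natural embedding
(here `p = j`). -/
noncomputable def natEmbDisc (j : ℕ) : ℕ → ℝ := fun m => if m < j then (m : ℝ) / j else 1


/-- Averaging over a product of sets with at most two elements is averaging over all choices
between the two (possibly equal) elements of each factor. -/
theorem sum_piFinset_pair_div_card {ι κ : Type*} [Fintype ι] [DecidableEq ι] [Fintype κ]
    [DecidableEq κ] (a b : ι → κ) (g : (ι → κ) → ℝ) :
    (∑ e ∈ Fintype.piFinset fun i => ({a i, b i} : Finset κ), g e) /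
        ((Fintype.piFinset fun i => ({a i, b i} : Finset κ)).card : ℝ) =
      (∑ s : ι → Bool, g fun i => if s i then b i else a i) / 2 ^ Fintype.card ι := by
  have hfib (i : ι) (m : κ) :
      (∑ t : Bool, if (if t then b i else a i) = m then (1 : ℝ) else 0) =
        if m ∈ ({a i, b i} : Finset κ) then 2 / ((({a i, b i} : Finset κ).card : ℕ) : ℝ) else 0 := by
    by_cases hab : a i = b i
    · by_cases hm : b i = m
      · simp [hab, hm]
      · simp [hab, hm, Ne.symm hm]
    · rw [Finset.card_pair hab]
      by_cases hm : b i = m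
      · subst hm; simp [hab]
      · by_cases hm' : a i = m
        · subst hm'; simp [hm]
        · simp [hm, hm', Ne.symm hm, Ne.symm hm']
  have hsum : (∑ s : ι → Bool, g fun i => if s i then b i else a i) =
      ∑ e : ι → κ, g e * ∏ i, ∑ t : Bool, if (if t then b i else a i) = e i then (1 : ℝ) else 0 := by
    simp_rw [Finset.prod_univ_sum, Fintype.piFinset_univ, Finset.mul_sum]
    rw [Finset.sum_comm]
    refine Finset.sum_congr rfl fun s _ => ?_
    simp_rw [Finset.prod_ite_zero, Finset.prod_const_one, mul_ite, mul_one, mul_zero,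
      Finset.mem_univ, true_imp_iff]
    rw [Finset.sum_eq_single fun i => if s i then b i else a i]
    · simp
    · intro e _ he
      rw [if_neg]
      intro h
      exact he (funext fun i => (h i).symm)
    · simp
  rw [hsum, Finset.sum_div, Finset.sum_div]
  have hprod (e : ι → κ) :
      (∏ i, ∑ t : Bool, if (if t then b i else a i) = e i then (1 : ℝ) else 0) =
        if e ∈ Fintype.piFinset fun i => ({a i, b i} : Finset κ) then 2 ^ Fintype.card ι /
          ((Fintype.piFinset fun i => ({a i, b i} : Finset κ)).card : ℝ) else 0 := by
    rw [Finset.prod_congr rfl fun i _ => hfib i (e i), Finset.prod_ite_zero]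
    simp only [Finset.prod_div_distrib, Finset.prod_const, Finset.card_univ, Finset.mem_univ,
      true_imp_iff, Fintype.mem_piFinset, Fintype.card_piFinset, Nat.cast_prod]
  rw [← Finset.sum_subset (Finset.subset_univ (Fintype.piFinset fun i => ({a i, b i} : Finset κ)))]
  · refine Finset.sum_congr rfl fun e he => ?_
    rw [hprod, if_pos he]
    field_simp
  · intro e _ he
    rw [hprod, if_neg he, mul_zero, zero_div]

theorem natEmbDisc_of_le {j m : ℕ} (hj : 0 < j) (hm : m ≤ j) : natEmbDisc j m = (m : ℝ) / j := by
  unfold natEmbDisc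
  split_ifs with h
  · rfl
  · obtain rfl : m = j := by omega
    field_simp

theorem mem_openBox_fullIdx {n j : ℕ} (hj : 0 < j) (eb : Fin n → Fin j) (x : Fin n → ℝ) :
    x ∈ openBox n (natEmbDisc j) (fullIdx eb) ↔
      ∀ i, ((eb i : ℕ) : ℝ) < x i * j ∧ x i * j < (eb i : ℕ) + 1 := by
  have hj' : (0 : ℝ) < j := by exact_mod_cast hj
  refine forall_congr' fun i => ?_
  have h1 : (2 * (eb i : ℕ) + 1) % 2 = 1 := by omega
  have h2 : (2 * (eb i : ℕ) + 1) / 2 = eb i := by omega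
  simp only [fullIdx, h1, h2, one_ne_zero, if_false]
  rw [natEmbDisc_of_le hj (eb i).2.le, natEmbDisc_of_le hj (eb i).2, div_lt_iff₀ hj',
    lt_div_iff₀ hj']
  push_cast
  rfl

theorem mem_closedBox_fullIdx {n j : ℕ} (hj : 0 < j) (eb : Fin n → Fin j) (x : Fin n → ℝ) :
    x ∈ closedBox n (natEmbDisc j) (fullIdx eb) ↔
      ∀ i, ((eb i : ℕ) : ℝ) ≤ x i * j ∧ x i * j ≤ (eb i : ℕ) + 1 := by
  have hj' : (0 : ℝ) < j := by exact_mod_cast hj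
  refine forall_congr' fun i => ?_
  have h1 : (2 * (eb i : ℕ) + 1 + 1) / 2 = eb i + 1 := by omega
  have h2 : (2 * (eb i : ℕ) + 1) / 2 = eb i := by omega
  simp only [fullIdx, h1, h2]
  rw [natEmbDisc_of_le hj (eb i).2.le, natEmbDisc_of_le hj (eb i).2, div_le_iff₀ hj',
    le_div_iff₀ hj']
  push_cast
  rfl

theorem center_mem_openBox {n j : ℕ} (hj : 0 < j) (eb : Fin n → Fin j) :
    center n (natEmbDisc j) (fullIdx eb) ∈ openBox n (natEmbDisc j) (fullIdx eb) := by
  rw [mem_openBox_fullIdx hj]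
  intro i
  have hj' : (0 : ℝ) < j := by exact_mod_cast hj
  have h1 : (2 * (eb i : ℕ) + 1 + 1) / 2 = eb i + 1 := by omega
  have h2 : (2 * (eb i : ℕ) + 1) / 2 = eb i := by omega
  have h : center n (natEmbDisc j) (fullIdx eb) i * j = (eb i : ℕ) + 1 / 2 := by
    simp only [center, fullIdx, h1, h2]
    rw [natEmbDisc_of_le hj (eb i).2.le, natEmbDisc_of_le hj (eb i).2]
    push_cast
    field_simp
    ring
  rw [h]
  constructor <;> linarith

/-- The smallest index of a cell `[m/j, (m+1)/j]` containing `t`. -/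
noncomputable def lowerCell (j : ℕ) (t : ℝ) : ℕ := min (⌈t * j⌉₊ - 1) (j - 1)

/-- The largest index of a cell `[m/j, (m+1)/j]` containing `t`. -/
noncomputable def upperCell (j : ℕ) (t : ℝ) : ℕ := min ⌊t * j⌋₊ (j - 1)

theorem lowerCell_mono (j : ℕ) : Monotone (lowerCell j) := fun s t h => by
  have : ⌈s * j⌉₊ ≤ ⌈t * j⌉₊ := Nat.ceil_mono (by gcongr)
  unfold lowerCell
  omega

theorem upperCell_mono (j : ℕ) : Monotone (upperCell j) := fun s t h => by
  have : ⌊s * j⌋₊ ≤ ⌊t * j⌋₊ := Nat.floor_mono (by gcongr)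
  unfold upperCell
  omega

theorem mem_cell_iff {j m : ℕ} (hm : m < j) {t : ℝ} (ht : t ∈ Set.Icc (0 : ℝ) 1) :
    ((m : ℝ) ≤ t * j ∧ t * j ≤ m + 1) ↔ m = lowerCell j t ∨ m = upperCell j t := by
  have hj' : (0 : ℝ) < j := by exact_mod_cast (by omega : 0 < j)
  have h0 : 0 ≤ t * j := mul_nonneg ht.1 hj'.le
  have h1 : t * j ≤ j := mul_le_of_le_one_left hj'.le ht.2
  have hC : ⌈t * j⌉₊ ≤ j := Nat.ceil_le.2 h1
  have hFC : ⌊t * j⌋₊ ≤ ⌈t * j⌉₊ := Nat.floor_le_ceil _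
  have hCF : ⌈t * j⌉₊ ≤ ⌊t * j⌋₊ + 1 := Nat.ceil_le_floor_add_one _
  rw [← Nat.le_floor_iff h0, ← Nat.cast_succ, ← Nat.ceil_le]
  unfold lowerCell upperCell
  omega

theorem lowerCell_eq_upperCell_eq {j m : ℕ} (hm : m < j) {t : ℝ}
    (h : t = 0 ∧ m = 0 ∨ t = 1 ∧ m = j - 1 ∨ (m : ℝ) < t * j ∧ t * j < m + 1) :
    lowerCell j t = m ∧ upperCell j t = m := by
  rcases h with ⟨rfl, rfl⟩ | ⟨rfl, rfl⟩ | ⟨h1, h2⟩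
  · simp [lowerCell, upperCell]
  · simp [lowerCell, upperCell]
  · have hF : ⌊t * j⌋₊ = m :=
      (Nat.floor_eq_iff ((Nat.cast_nonneg m).trans h1.le)).2 ⟨h1.le, h2⟩
    have hC : ⌈t * j⌉₊ = m + 1 := (Nat.ceil_eq_iff (by omega)).2 (by simpa using ⟨h1, h2.le⟩)
    unfold lowerCell upperCell
    omega

/-- The value of the natural embedding of `v` at a point of the cube: the average of `v` over all
ways of rounding each coordinate to the lower or to the upper cell containing it. -/
noncomputable def cellAverage (n j k : ℕ) (v : (Fin n → ℕ) → ℕ) (x : Fin n → ℝ) : ℝ :=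
  (∑ s : Fin n → Bool,
    (v (fun i => if s i then upperCell j (x i) else lowerCell j (x i)) : ℝ) / ((k : ℝ) - 1)) /
      2 ^ n

theorem cellAverage_of_forall {n j k : ℕ} (v : (Fin n → ℕ) → ℕ) {x : Fin n → ℝ} {m : Fin n → ℕ}
    (hm : ∀ i, m i < j)
    (h : ∀ i, x i = 0 ∧ m i = 0 ∨ x i = 1 ∧ m i = j - 1 ∨ (m i : ℝ) < x i * j ∧ x i * j < m i + 1) :
    cellAverage n j k v x = (v m : ℝ) / ((k : ℝ) - 1) := by
  have hcell i := lowerCell_eq_upperCell_eq (hm i) (h i)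
  simp only [cellAverage, (hcell _).1, (hcell _).2, ite_self, Finset.sum_const, Finset.card_univ,
    Fintype.card_pi, Fintype.card_bool, Finset.prod_const, Fintype.card_fin, nsmul_eq_mul]
  push_cast
  field_simp

theorem cellAverage_mono {n j k : ℕ} (hk : 1 ≤ k) {v : (Fin n → ℕ) → ℕ}
    (hv : IsJKGame n j k v) : Monotone (cellAverage n j k v) := by
  intro x y hxy
  have hk' : (0 : ℝ) ≤ (k : ℝ) - 1 := by
    have : (1 : ℝ) ≤ k := by exact_mod_cast hk
    linarith
  unfold cellAverage
  gcongr with s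
  refine hv.2.2.2 _ _ (fun i => ?_) (fun i => ?_)
  · unfold upperCell lowerCell
    split_ifs <;> exact min_le_right _ _
  · split_ifs
    exacts [upperCell_mono j (hxy i), lowerCell_mono j (hxy i)]

theorem eq_cellAverage {n j k : ℕ} (hj : 0 < j) (hk : 2 ≤ k) {v : (Fin n → ℕ) → ℕ}
    (hv : IsJKGame n j k v) {f : (Fin n → ℝ) → ℝ} (hreg : RegularStep n j (natEmbDisc j) f)
    (hval : ∀ eb : Fin n → Fin j, ∀ x ∈ openBox n (natEmbDisc j) (fullIdx eb),
      f x = (v (fun i => (eb i : ℕ)) : ℝ) / ((k : ℝ) - 1))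
    {x : Fin n → ℝ} (hx : x ∈ cube n) : f x = cellAverage n j k v x := by
  have hk' : (k : ℝ) - 1 ≠ 0 := by
    have : (2 : ℝ) ≤ k := by exact_mod_cast hk
    linarith
  by_cases h0 : x = fun _ => 0
  · subst h0
    rw [hreg.2.1, cellAverage_of_forall v (m := fun _ => 0) (fun _ => hj) (by simp), hv.1]
    simp
  by_cases h1 : x = fun _ => 1
  · subst h1
    rw [hreg.2.2.1, cellAverage_of_forall v (m := fun _ => j - 1) (fun _ => by omega) (by simp),
      hv.2.1, Nat.cast_sub (by omega), Nat.cast_one, div_self hk']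
  let a : Fin n → Fin j := fun i => ⟨lowerCell j (x i), by unfold lowerCell; omega⟩
  let b : Fin n → Fin j := fun i => ⟨upperCell j (x i), by unfold upperCell; omega⟩
  have hE : Ecal n j (natEmbDisc j) x = Fintype.piFinset fun i => ({a i, b i} : Finset (Fin j)) := by
    ext eb
    simp only [Ecal, Finset.mem_filter, Finset.mem_univ, true_and, Fintype.mem_piFinset,
      Finset.mem_insert, Finset.mem_singleton, mem_closedBox_fullIdx hj]
    refine forall_congr' fun i => ?_
    rw [mem_cell_iff (eb i).2 (hx i)]
    simp only [a, b, Fin.ext_iff]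
  rw [hreg.2.2.2 x hx h0 h1, hE]
  simp_rw [fun eb => hval eb _ (center_mem_openBox hj eb)]
  rw [sum_piFinset_pair_div_card a b fun eb => (v (fun i => (eb i : ℕ)) : ℝ) / ((k : ℝ) - 1),
    Fintype.card_fin]
  unfold cellAverage
  congr! 6 with s _ i
  by_cases h : s i <;> simp [h, a, b]

theorem openBox_fullIdx_eq_pi {n j : ℕ} (hj : 0 < j) (eb : Fin n → Fin j) :
    openBox n (natEmbDisc j) (fullIdx eb) =
      Set.univ.pi fun i => Set.Ioo (((eb i : ℕ) : ℝ) / j) ((((eb i : ℕ) : ℝ) + 1) / j) := by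
  have hj' : (0 : ℝ) < j := by exact_mod_cast hj
  ext x
  rw [mem_openBox_fullIdx hj]
  simp only [Set.mem_univ_pi, Set.mem_Ioo, div_lt_iff₀ hj', lt_div_iff₀ hj']

theorem measurableSet_openBox_fullIdx {n j : ℕ} (hj : 0 < j) (eb : Fin n → Fin j) :
    MeasurableSet (openBox n (natEmbDisc j) (fullIdx eb)) := by
  rw [openBox_fullIdx_eq_pi hj]
  exact MeasurableSet.univ_pi fun _ => measurableSet_Ioo

theorem volume_openBox_fullIdx {n j : ℕ} (hj : 0 < j) (eb : Fin n → Fin j) :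
    volume (openBox n (natEmbDisc j) (fullIdx eb)) = ENNReal.ofReal ((1 / j) ^ n) := by
  rw [openBox_fullIdx_eq_pi hj, Real.volume_pi_Ioo, ENNReal.ofReal_pow (by positivity)]
  have (m : ℝ) : (m + 1) / j - m / j = 1 / j := by ring
  simp [this]

theorem pairwise_disjoint_openBox_fullIdx {n j : ℕ} (hj : 0 < j) :
    Pairwise (Function.onFun Disjoint fun eb : Fin n → Fin j =>
      openBox n (natEmbDisc j) (fullIdx eb)) := by
  intro e e' hne
  refine Set.disjoint_left.2 fun x hx hx' => hne (funext fun i => Fin.ext ?_)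
  rw [mem_openBox_fullIdx hj] at hx hx'
  have h1 : ((e i : ℕ) : ℝ) < (e' i : ℕ) + 1 := (hx i).1.trans (hx' i).2
  have h2 : ((e' i : ℕ) : ℝ) < (e i : ℕ) + 1 := (hx' i).1.trans (hx i).2
  norm_cast at h1 h2
  omega

theorem openBox_fullIdx_subset_cube {n j : ℕ} (hj : 0 < j) (eb : Fin n → Fin j) :
    openBox n (natEmbDisc j) (fullIdx eb) ⊆ cube n := by
  intro x hx i
  have hj' : (0 : ℝ) < j := by exact_mod_cast hj
  have h := (mem_openBox_fullIdx hj eb x).1 hx i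
  have h1 : ((eb i : ℕ) : ℝ) + 1 ≤ j := by exact_mod_cast (eb i).2
  constructor
  · exact (pos_of_mul_pos_left ((Nat.cast_nonneg _).trans_lt h.1) hj'.le).le
  · exact le_of_mul_le_mul_right (by linarith) hj'

theorem iUnion_openBox_ae_eq_cube {n j : ℕ} (hj : 0 < j) :
    (⋃ eb : Fin n → Fin j, openBox n (natEmbDisc j) (fullIdx eb) : Set (Fin n → ℝ)) =ᵐ[volume]
      cube n := by
  have hj' : (0 : ℝ) < j := by exact_mod_cast hj
  have hcube : volume (cube n) = 1 := by
    have : cube n = Set.Icc (fun _ => (0 : ℝ)) (fun _ => 1) := by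
      ext x
      simp [cube, Pi.le_def, forall_and]
    rw [this, Real.volume_Icc_pi]
    simp
  have hmeas := fun eb : Fin n → Fin j => measurableSet_openBox_fullIdx hj eb
  refine ae_eq_of_subset_of_measure_ge (Set.iUnion_subset (openBox_fullIdx_subset_cube hj)) ?_
    (MeasurableSet.iUnion hmeas).nullMeasurableSet (by simp [hcube])
  rw [hcube, measure_iUnion (pairwise_disjoint_openBox_fullIdx hj) hmeas, tsum_fintype]
  simp_rw [volume_openBox_fullIdx hj]
  rw [← ENNReal.ofReal_sum_of_nonneg fun _ _ => by positivity]
  have : (∑ _eb : Fin n → Fin j, (1 / (j : ℝ)) ^ n) = 1 := by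
    simp [hj'.ne']
  rw [this, ENNReal.ofReal_one]

theorem setIntegral_cube_of_forall_openBox {n j : ℕ} (hj : 0 < j) {F : (Fin n → ℝ) → ℝ}
    {c : (Fin n → Fin j) → ℝ}
    (h : ∀ eb, ∀ x ∈ openBox n (natEmbDisc j) (fullIdx eb), F x = c eb) :
    ∫ x in cube n, F x = (1 / (j : ℝ) ^ n) * ∑ eb, c eb := by
  have hmeas := fun eb : Fin n → Fin j => measurableSet_openBox_fullIdx hj eb
  rw [← setIntegral_congr_set (iUnion_openBox_ae_eq_cube hj), integral_iUnion_fintype hmeas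
    (pairwise_disjoint_openBox_fullIdx hj), Finset.mul_sum]
  · refine Finset.sum_congr rfl fun eb _ => ?_
    rw [setIntegral_congr_fun (hmeas eb) (h eb), setIntegral_const, measureReal_def,
      volume_openBox_fullIdx hj, ENNReal.toReal_ofReal (by positivity), smul_eq_mul, div_pow,
      one_pow]
  · intro eb
    refine (integrableOn_congr_fun (h eb) (hmeas eb)).2 (integrableOn_const ?_)
    rw [volume_openBox_fullIdx hj]
    exact ENNReal.ofReal_ne_top

/-- The number of orderings of the players in which the coalition of `i` and its successors
is `S`. -/
theorem card_perm_filter_eq {n : ℕ} (i : Fin n) (S : Finset (Fin n)) (hi : i ∈ S) :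
    (Finset.univ.filter fun π : Equiv.Perm (Fin n) =>
      (Finset.univ.filter fun j => π i ≤ π j) = S).card =
      (S.card - 1).factorial * (n - S.card).factorial := by
  classical
  have hS : 0 < S.card := Finset.card_pos.2 ⟨i, hi⟩
  have hSn : S.card ≤ n := by simpa using S.card_le_univ
  let f : Fin n → Fin 3 := fun a => if a = i then 1 else if a ∈ S then 2 else 0
  let p : Fin n := ⟨n - S.card, by omega⟩
  let g : Fin n → Fin 3 := fun a => if a = p then 1 else if p < a then 2 else 0
  have hf0 : Fintype.card {a // f a = 0} = n - S.card := by
    rw [Fintype.card_subtype]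
    have : (Finset.univ.filter fun a => f a = 0) = Sᶜ := by
      ext a; simp only [f]; by_cases h : a = i
      · simp [h, hi]
      · by_cases h' : a ∈ S <;> simp [h, h']
    rw [this, Finset.card_compl, Fintype.card_fin]
  have hf1 : Fintype.card {a // f a = 1} = 1 := by
    rw [Fintype.card_subtype]
    have : (Finset.univ.filter fun a => f a = 1) = {i} := by
      ext a; simp only [f]; by_cases h : a = i
      · simp [h]
      · by_cases h' : a ∈ S <;> simp [h, h']
    rw [this, Finset.card_singleton]
  have hf2 : Fintype.card {a // f a = 2} = S.card - 1 := by
    rw [Fintype.card_subtype]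
    have : (Finset.univ.filter fun a => f a = 2) = S.erase i := by
      ext a; simp only [f]; by_cases h : a = i
      · simp [h]
      · by_cases h' : a ∈ S <;> simp [h, h']
    rw [this, Finset.card_erase_of_mem hi]
  have hg0 : Fintype.card {a // g a = 0} = n - S.card := by
    rw [Fintype.card_subtype]
    have : (Finset.univ.filter fun a => g a = 0) = Finset.Iio p := by
      ext a; simp only [g]; rcases lt_trichotomy a p with h | h | h
      · simp [h, h.ne, h.le]
      · simp [h]
      · simp [h, h.ne', h.le]
    rw [this, Fin.card_Iio]
  have hg1 : Fintype.card {a // g a = 1} = 1 := by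
    rw [Fintype.card_subtype]
    have : (Finset.univ.filter fun a => g a = 1) = {p} := by
      ext a; simp only [g]; rcases lt_trichotomy a p with h | h | h
      · simp [h.ne, h.not_gt]
      · simp [h]
      · simp [h, h.ne']
    rw [this, Finset.card_singleton]
  have hg2 : Fintype.card {a // g a = 2} = S.card - 1 := by
    rw [Fintype.card_subtype]
    have : (Finset.univ.filter fun a => g a = 2) = Finset.Ioi p := by
      ext a; simp only [g]; rcases lt_trichotomy a p with h | h | h
      · simp [h.ne, h.not_gt]
      · simp [h]
      · simp [h, h.ne']
    rw [this, Fin.card_Ioi]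
    simp only [p]
    omega
  have hfg (c : Fin 3) : Fintype.card {a // f a = c} = Fintype.card {a // g a = c} := by
    fin_cases c
    exacts [hf0.trans hg0.symm, hf1.trans hg1.symm, hf2.trans hg2.symm]
  let π₀ : Equiv.Perm (Fin n) := Equiv.ofFiberEquiv fun c => Fintype.equivOfCardEq (hfg c)
  have hπ₀ (a : Fin n) : g (π₀ a) = f a := Equiv.ofFiberEquiv_map _ a
  have hiff (π : Equiv.Perm (Fin n)) :
      (Finset.univ.filter fun j => π i ≤ π j) = S ↔ ∀ a, g (π a) = f a := by
    constructor
    · intro h a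
      have hpi : π i = p := by
        have : (Finset.Ici (π i)).card = S.card :=
          Finset.card_equiv π.symm (by simp [← h])
        rw [Fin.card_Ici] at this
        ext
        simp only [p]
        omega
      have hmem : a ∈ S ↔ p ≤ π a := by rw [← h, ← hpi]; simp
      have heq : a = i ↔ π a = p := by rw [← hpi, π.apply_eq_iff_eq]
      simp only [f, g, heq, hmem]
      by_cases h1 : π a = p
      · simp [h1]
      · simp only [h1, if_false, lt_iff_le_and_ne, ne_eq, Ne.symm h1, not_false_eq_true, and_true]
    · intro h
      have hpi : π i = p := by
        have := h i
        by_contra hne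
        simp only [f, g, if_true, hne, if_false] at this
        split_ifs at this
        all_goals simp at this
      ext a
      have ha := h a
      rw [Finset.mem_filter, hpi]
      simp only [f, g, Finset.mem_univ, true_and] at ha ⊢
      have heq : a = i ↔ π a = p := by rw [← hpi, π.apply_eq_iff_eq]
      by_cases h1 : π a = p
      · rw [heq.2 h1, hpi]; simp [hi]
      · rw [if_neg h1, if_neg (mt heq.1 h1)] at ha
        have h2 : p ≤ π a ↔ p < π a := by
          rw [lt_iff_le_and_ne]; simp [Ne.symm h1]
        rw [h2]
        by_cases h3 : p < π a <;> by_cases h4 : a ∈ S <;> simp_all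
  simp_rw [hiff]
  rw [← Fintype.card_subtype, Fintype.card_congr
    (β := {σ : Equiv.Perm (Fin n) // f ∘ σ = f}) ((Equiv.mulLeft π₀⁻¹).subtypeEquiv fun π => ?_)]
  · rw [DomMulAct.stabilizer_card, Fin.prod_univ_three, hf0, hf1, hf2, Nat.factorial_one, mul_one,
      mul_comm]
  · rw [funext_iff]
    refine forall_congr' fun a => ?_
    rw [Function.comp_apply, ← hπ₀ ((Equiv.mulLeft π₀⁻¹ π) a)]
    simp

/-- Let `v` be a `(j,k)` simple game and let `v̂` be the regular step
function with discretization `(0, 1/j, …, (j−1)/j, 1)` determined by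
`v̂(x) = v(ē − 1/2·1)/(k−1)` on each full-dimensional open box `(α)_{ē}`.
Then `v̂` is an interval simple game and `SSI(v) = Ψ(v̂)`. -/
theorem natural_embedding_SSI_eq_Psi (n : ℕ) (hn : 1 ≤ n) (j k : ℕ) (hj : 2 ≤ j)
    (hk : 2 ≤ k) (v : (Fin n → ℕ) → ℕ) (hv : IsJKGame n j k v)
    (vhat : (Fin n → ℝ) → ℝ) (hreg : RegularStep n j (natEmbDisc j) vhat)
    (hval : ∀ eb : Fin n → Fin j, ∀ x ∈ openBox n (natEmbDisc j) (fullIdx eb),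
      vhat x = (v (fun i => (eb i : ℕ)) : ℝ) / ((k : ℝ) - 1)) :
    IsISG n vhat ∧ ∀ i : Fin n, jkSSI n j k v i = Psi n vhat i := by
  have hj0 : 0 < j := by omega
  have heq {x : Fin n → ℝ} (hx : x ∈ cube n) : vhat x = cellAverage n j k v x :=
    eq_cellAverage hj0 hk hv hreg hval hx
  have hmono : ∀ x ∈ cube n, ∀ y ∈ cube n, (∀ i, x i ≤ y i) → vhat x ≤ vhat y := by
    intro x hx y hy hxy
    rw [heq hx, heq hy]
    exact cellAverage_mono (by omega) hv hxy
  refine ⟨⟨hreg.2.1, hreg.2.2.1, fun x hx => ⟨?_, ?_⟩, hmono⟩, fun i => ?_⟩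
  · rw [← hreg.2.1]
    exact hmono _ (fun _ => by simp) x hx fun i => (hx i).1
  · rw [← hreg.2.2.1]
    exact hmono x hx _ (fun _ => by simp) fun i => (hx i).2
  have hone (S : Finset (Fin n)) (eb : Fin n → Fin j) (x : Fin n → ℝ)
      (hx : x ∈ openBox n (natEmbDisc j) (fullIdx eb)) :
      vhat (fun a => if a ∈ S then 1 else x a) =
        (v (fun a => if a ∈ S then j - 1 else (eb a : ℕ)) : ℝ) / ((k : ℝ) - 1) := by
    have hc := openBox_fullIdx_subset_cube hj0 eb hx
    rw [heq fun a => ?_, cellAverage_of_forall]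
    · intro a
      split_ifs
      exacts [by omega, (eb a).2]
    · intro a
      by_cases ha : a ∈ S
      · simp [ha]
      · simpa [ha] using Or.inr (Or.inr ((mem_openBox_fullIdx hj0 eb x).1 hx a))
    · split_ifs
      exacts [by simp, hc a]
  have hzero (S : Finset (Fin n)) (eb : Fin n → Fin j) (x : Fin n → ℝ)
      (hx : x ∈ openBox n (natEmbDisc j) (fullIdx eb)) :
      vhat (fun a => if a ∈ S then 0 else x a) =
        (v (fun a => if a ∈ S then 0 else (eb a : ℕ)) : ℝ) / ((k : ℝ) - 1) := by
    have hc := openBox_fullIdx_subset_cube hj0 eb hx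
    rw [heq fun a => ?_, cellAverage_of_forall]
    · intro a
      split_ifs
      exacts [by omega, (eb a).2]
    · intro a
      by_cases ha : a ∈ S
      · simp [ha]
      · simpa [ha] using Or.inr (Or.inr ((mem_openBox_fullIdx hj0 eb x).1 hx a))
    · split_ifs
      exacts [by simp, hc a]
  have hint (π : Equiv.Perm (Fin n)) :
      (∫ x in cube n,
        ((vhat (fun a => if π a < π i then x a else 1) -
          vhat (fun a => if π a < π i then x a else 0)) -
         (vhat (fun a => if π a ≤ π i then x a else 1) -
          vhat (fun a => if π a ≤ π i then x a else 0)))) =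
      jkC n j k v (Finset.univ.filter fun a => π i ≤ π a) -
        jkC n j k v ((Finset.univ.filter fun a => π i ≤ π a).erase i) := by
    set S := Finset.univ.filter fun a => π i ≤ π a with hS
    have hlt (x : Fin n → ℝ) (c : ℝ) :
        (fun a => if π a < π i then x a else c) = fun a => if a ∈ S then c else x a := by
      funext a
      simp only [hS, Finset.mem_filter, Finset.mem_univ, true_and, ← not_lt, ite_not]
    have hle (x : Fin n → ℝ) (c : ℝ) :
        (fun a => if π a ≤ π i then x a else c) = fun a => if a ∈ S.erase i then c else x a := by
      funext a
      have : a ∈ S.erase i ↔ ¬ π a ≤ π i := by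
        rw [Finset.mem_erase, hS, Finset.mem_filter, not_le, lt_iff_le_and_ne, ne_comm (a := π i),
          π.injective.ne_iff]
        simp [and_comm]
      simp only [this, ite_not]
    simp_rw [hlt, hle]
    rw [setIntegral_cube_of_forall_openBox hj0 fun eb x hx => by
      rw [hone S eb x hx, hone (S.erase i) eb x hx, hzero S eb x hx, hzero (S.erase i) eb x hx]]
    simp only [jkC, ← sub_div, ← Finset.sum_div, Finset.sum_sub_distrib]
    rw [one_div_mul_eq_div, one_div_mul_eq_div, one_div_mul_eq_div, div_div, ← sub_div,
      mul_comm ((j : ℝ) ^ n)]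
  unfold Psi jkSSI
  simp_rw [hint]
  rw [← Finset.sum_fiberwise_of_maps_to (s := Finset.univ)
    (t := Finset.univ.powerset.filter fun S : Finset (Fin n) => i ∈ S)
    (g := fun π : Equiv.Perm (Fin n) => Finset.univ.filter fun a => π i ≤ π a) (by simp),
    Finset.mul_sum]
  refine Finset.sum_congr rfl fun S hS => ?_
  rw [Finset.sum_congr rfl fun π hπ => by rw [(Finset.mem_filter.1 hπ).2], Finset.sum_const,
    card_perm_filter_eq i S (Finset.mem_filter.1 hS).2, nsmul_eq_mul]
  ring
end

section
/- Let k ≥ 2 be an integer, τ ∈ (0,1), and let v be a (2,k) simple game on n players. Let v̂ be the regular step function with discretization α = (0, τ, 1) determined by v̂(x) = v(ē − (1/2,…,1/2))/(k−1) for all x ∈ (α)_{ē} and all ē ∈ Ā_2. Then SSI_i(v) = Ψ_i(v̂) for all i ∈ N (independently of τ). -/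
open MeasureTheory

/-- The discretization `α = (0, τ, 1)` (with `p = 2`). -/
def tauDisc (τ : ℝ) : ℕ → ℝ := fun m => if m = 0 then 0 else if m = 1 then τ else 1

lemma card_perm_prefix {n : ℕ} (s : Finset (Fin n)) :
    (Finset.univ.filter fun π : Equiv.Perm (Fin n) => ∀ x, x ∈ s ↔ (π x : ℕ) < s.card).card
      = s.card.factorial * (n - s.card).factorial := by
  have h := Numbering.card_prefixed s
  rw [Fintype.card_fin] at h
  rw [← h]
  refine Finset.card_equiv (Equiv.equivCongr (Equiv.refl _) (finCongr (Fintype.card_fin n).symm)) ?_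
  intro π
  simp [Numbering.IsPrefix]

/-- The players that do not precede `i` in the ordering `π`. -/
def upSet {n : ℕ} (π : Equiv.Perm (Fin n)) (i : Fin n) : Finset (Fin n) :=
  Finset.univ.filter fun j => π i ≤ π j

@[simp] lemma mem_upSet {n : ℕ} {π : Equiv.Perm (Fin n)} {i j : Fin n} :
    j ∈ upSet π i ↔ π i ≤ π j := by simp [upSet]

lemma upSet_mul {n : ℕ} (π σ : Equiv.Perm (Fin n)) (i : Fin n) :
    (upSet (π * σ) i).map σ.toEmbedding = upSet π (σ i) := by
  ext j
  simp only [Finset.mem_map_equiv, mem_upSet, Equiv.Perm.mul_apply, Equiv.apply_symm_apply]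

lemma map_swap_eq_self {n : ℕ} {S : Finset (Fin n)} {i j : Fin n} (h : i ∈ S ↔ j ∈ S) :
    S.map (Equiv.swap i j).toEmbedding = S := by
  ext a
  rw [Finset.mem_map_equiv, Equiv.symm_swap]
  rcases eq_or_ne a i with rfl | hi
  · simp [h]
  rcases eq_or_ne a j with rfl | hj
  · simp [h]
  · rw [Equiv.swap_apply_of_ne_of_ne hi hj]

lemma card_upSet {n : ℕ} (π : Equiv.Perm (Fin n)) (i : Fin n) :
    (upSet π i).card = n - (π i : ℕ) := by
  have : (upSet π i).map π.toEmbedding = Finset.Ici (π i) := by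
    ext j
    simp [Finset.mem_map_equiv]
  rw [← Finset.card_map π.toEmbedding, this, Fin.card_Ici]

lemma card_upSet_eq {n : ℕ} {S : Finset (Fin n)} {i : Fin n} (hi : i ∈ S) :
    (Finset.univ.filter fun π : Equiv.Perm (Fin n) => upSet π i = S).card
      = (S.card - 1).factorial * (n - S.card).factorial := by
  have hSn : S.card ≤ n := by simpa using S.card_le_univ
  have hS : 0 < S.card := Finset.card_pos.2 ⟨i, hi⟩
  have hswap : ∀ j ∈ S, (Finset.univ.filter fun π : Equiv.Perm (Fin n) => upSet π j = S).card
      = (Finset.univ.filter fun π : Equiv.Perm (Fin n) => upSet π i = S).card := by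
    intro j hj
    refine Finset.card_equiv (Equiv.mulRight (Equiv.swap i j)) fun π => ?_
    have hm : S.map (Equiv.swap i j).toEmbedding = S := map_swap_eq_self (by simp [hi, hj])
    have := upSet_mul π (Equiv.swap i j) i
    rw [Equiv.swap_apply_left] at this
    simp only [Finset.mem_filter, Finset.mem_univ, true_and, Equiv.coe_mulRight, ← this]
    constructor
    · intro h
      exact Finset.map_injective _ (h.trans hm.symm)
    · intro h
      rw [h, hm]
  have hunion : (Finset.univ.filter fun π : Equiv.Perm (Fin n) =>
      ∀ x, x ∈ Sᶜ ↔ (π x : ℕ) < Sᶜ.card)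
      = S.biUnion fun j => Finset.univ.filter fun π : Equiv.Perm (Fin n) => upSet π j = S := by
    ext π
    simp only [Finset.mem_filter, Finset.mem_univ, true_and, Finset.mem_biUnion,
      Finset.card_compl, Fintype.card_fin, Finset.mem_compl]
    constructor
    · intro h
      have hlt : n - S.card < n := by omega
      have hmem : ∀ x, x ∈ S ↔ n - S.card ≤ (π x : ℕ) := fun x => by
        rw [← not_lt, ← h x, not_not]
      refine ⟨π.symm ⟨n - S.card, hlt⟩, ?_, ?_⟩
      · rw [hmem]; simp
      · ext x
        rw [hmem, mem_upSet]
        simp [Fin.le_def]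
    · rintro ⟨j, hj, h⟩ x
      have hc := card_upSet π j
      have hx := mem_upSet (π := π) (i := j) (j := x)
      rw [h] at hc hx
      have := (π j).2
      rw [hx, Fin.le_def]
      omega
  have hcard := card_perm_prefix Sᶜ
  rw [hunion, Finset.card_biUnion, Finset.sum_congr rfl hswap, Finset.sum_const,
    Finset.card_compl, Fintype.card_fin, Nat.sub_sub_self hSn, smul_eq_mul,
    ← Nat.mul_factorial_pred hS.ne'] at hcard
  · apply Nat.eq_of_mul_eq_mul_left hS
    rw [hcard]
    ring
  · intro a ha b hb hab
    refine Finset.disjoint_left.2 ?_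
    intro π h1 h2
    simp only [Finset.mem_filter, Finset.mem_univ, true_and] at h1 h2
    have hab' : b ∈ upSet π a := h1 ▸ hb
    have hba' : a ∈ upSet π b := h2 ▸ ha
    exact hab (π.injective (le_antisymm (mem_upSet.1 hab') (mem_upSet.1 hba')))

/-- The sum over all orderings `π` of the marginal contributions of `i` to `C`. -/
def marginalSum {n : ℕ} (C : Finset (Fin n) → ℝ) (i : Fin n) : ℝ :=
  ∑ π : Equiv.Perm (Fin n), (C (upSet π i) - C ((upSet π i).erase i))

lemma marginalSum_eq_sum_subsets {n : ℕ} (C : Finset (Fin n) → ℝ) (i : Fin n) :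
    marginalSum C i = ∑ S ∈ Finset.univ.powerset.filter (fun S : Finset (Fin n) => i ∈ S),
      (((S.card - 1).factorial * (n - S.card).factorial : ℕ) : ℝ) * (C S - C (S.erase i)) := by
  rw [marginalSum, ← Finset.sum_fiberwise_of_maps_to (g := fun π => upSet π i)
    (t := Finset.univ.powerset.filter (fun S : Finset (Fin n) => i ∈ S)) (by simp)]
  refine Finset.sum_congr rfl fun S hS => ?_
  rw [Finset.sum_congr rfl (g := fun _ => C S - C (S.erase i)), Finset.sum_const,
    card_upSet_eq (Finset.mem_filter.1 hS).2, nsmul_eq_mul]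
  intro π hπ
  rw [(Finset.mem_filter.1 hπ).2]

lemma marginalSum_eq_of_symm {n : ℕ} (C : Finset (Fin n) → ℝ) (i j : Fin n)
    (hC : ∀ S, C (S.map (Equiv.swap i j).toEmbedding) = C S) :
    marginalSum C j = marginalSum C i := by
  refine Fintype.sum_equiv (Equiv.mulRight (Equiv.swap i j)) _ _ fun π => ?_
  have h := upSet_mul π (Equiv.swap i j) i
  rw [Equiv.swap_apply_left] at h
  have h' : (upSet π j).erase j
      = ((upSet (π * Equiv.swap i j) i).erase i).map (Equiv.swap i j).toEmbedding := by
    rw [Finset.map_erase, h]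
    simp
  rw [h', ← h, hC, hC]
  rfl

lemma sum_marginalSum {n : ℕ} (C : Finset (Fin n) → ℝ) :
    ∑ i, marginalSum C i = n.factorial * (C Finset.univ - C ∅) := by
  simp only [marginalSum]
  rw [Finset.sum_comm]
  have key : ∀ π : Equiv.Perm (Fin n),
      ∑ i, (C (upSet π i) - C ((upSet π i).erase i)) = C Finset.univ - C ∅ := by
    intro π
    let f : ℕ → ℝ := fun m => C (Finset.univ.filter fun j => m ≤ (π j : ℕ))
    have : ∀ i, C (upSet π i) - C ((upSet π i).erase i) = f (π i) - f (π i + 1) := by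
      intro i
      congr 2
      ext j
      have : j = i ↔ (π j : ℕ) = π i := by rw [← Fin.ext_iff, π.injective.eq_iff]
      simp only [Finset.mem_erase, ne_eq, this, mem_upSet, Fin.le_def, Finset.mem_filter,
        Finset.mem_univ, true_and]
      omega
    rw [Finset.sum_congr rfl fun i _ => this i,
      Equiv.sum_comp π fun m : Fin n => f m - f (m + 1),
      Fin.sum_univ_eq_sum_range (fun m => f m - f (m + 1)), Finset.sum_range_sub']
    have h0 : (Finset.univ.filter fun j => 0 ≤ (π j : ℕ)) = Finset.univ := by simp
    have hn : (Finset.univ.filter fun j => n ≤ (π j : ℕ)) = ∅ := by simp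
    simp only [f, h0, hn]
  rw [Finset.sum_congr rfl fun π _ => key π]
  rw [Finset.sum_const, Finset.card_univ, Fintype.card_perm, Fintype.card_fin, nsmul_eq_mul]

/-- The expected difference made to `G` by the coalition `T` when the complement of `T`
votes according to a random set with weights `q`. -/
def swing {n : ℕ} (q G : Finset (Fin n) → ℝ) (T : Finset (Fin n)) : ℝ :=
  ∑ X, q X * (G (X ∪ T) - G (X \ T))

lemma marginalSum_swing_unanimity {n : ℕ} (q : Finset (Fin n) → ℝ)
    (hq : ∀ X Y, X.card = Y.card → q X = q Y) (hq1 : ∑ X, q X = 1)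
    (A : Finset (Fin n)) (i : Fin n) :
    marginalSum (swing q fun X => if A ⊆ X then 1 else 0) i
      = if i ∈ A then (n.factorial : ℝ) / A.card else 0 := by
  set C := swing q fun X => if A ⊆ X then 1 else 0 with hC
  have hnull : ∀ j ∉ A, marginalSum C j = 0 := by
    intro j hj
    refine Finset.sum_eq_zero fun π _ => sub_eq_zero.2 ?_
    refine Finset.sum_congr rfl fun X _ => ?_
    have h1 : A ⊆ X ∪ upSet π j ↔ A ⊆ X ∪ (upSet π j).erase j := by
      refine forall₂_congr fun a ha => ?_
      have : a ≠ j := fun h => hj (h ▸ ha)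
      simp [this]
    have h2 : A ⊆ X \ upSet π j ↔ A ⊆ X \ (upSet π j).erase j := by
      refine forall₂_congr fun a ha => ?_
      have : a ≠ j := fun h => hj (h ▸ ha)
      simp [this]
    simp only [h1, h2]
  split_ifs with hi
  · have hsymm : ∀ j ∈ A, marginalSum C j = marginalSum C i := by
      intro j hj
      refine marginalSum_eq_of_symm C i j fun S => ?_
      have hA : A.map (Equiv.swap i j).toEmbedding = A := map_swap_eq_self (by simp [hi, hj])
      refine (Fintype.sum_equiv (Equiv.finsetCongr (Equiv.swap i j)) _ _ fun X => ?_).symm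
      rw [Equiv.finsetCongr_apply, hq (X.map _) X (Finset.card_map _), ← Finset.map_union]
      have hd : X.map (Equiv.swap i j).toEmbedding \ S.map (Equiv.swap i j).toEmbedding
          = (X \ S).map (Equiv.swap i j).toEmbedding := by
        ext; simp
      have hsub : ∀ Y, A ⊆ Y.map (Equiv.swap i j).toEmbedding ↔ A ⊆ Y := fun Y => by
        conv_lhs => rw [← hA]
        exact Finset.map_subset_map
      simp only [hd, hsub]
    have hA0 : A.Nonempty := ⟨i, hi⟩
    have htot := sum_marginalSum C
    rw [← Finset.sum_subset (Finset.subset_univ A) fun j _ hj => hnull j hj,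
      Finset.sum_congr rfl hsymm, Finset.sum_const, nsmul_eq_mul] at htot
    have hu : C Finset.univ = 1 := by
      rw [← hq1]
      refine Finset.sum_congr rfl fun X _ => ?_
      have h1 : A ⊆ X ∪ Finset.univ := fun a _ => by simp
      have h0 : ¬ A ⊆ X \ Finset.univ := fun h => by simpa using h hi
      simp only [h1, h0, if_true, if_false, sub_zero, mul_one]
    have he : C ∅ = 0 := by simp [hC, swing]
    rw [hu, he] at htot
    have : (A.card : ℝ) ≠ 0 := by simp [hA0.ne_empty]
    field_simp
    linarith
  · exact hnull i hi

/-- A linear functional on set functions is determined by its values on unanimity games. -/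
lemma linearMap_eq_zero_of_unanimity {ι : Type*} [Fintype ι] [DecidableEq ι]
    (L : (Finset ι → ℝ) →ₗ[ℝ] ℝ) (hL : ∀ A : Finset ι, L (fun X => if A ⊆ X then 1 else 0) = 0) :
    L = 0 := by
  have hs : ∀ m, ∀ B : Finset ι, Bᶜ.card = m → L (Pi.single B 1) = 0 := by
    intro m
    induction m using Nat.strong_induction_on with
    | _ m ih =>
      intro B hB
      have h1 : (fun X => if B ⊆ X then (1 : ℝ) else 0)
          = ∑ A ∈ Finset.univ.filter (B ⊆ ·), Pi.single A (1 : ℝ) := by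
        ext X
        simp [Finset.sum_apply, Pi.single_apply]
      have h2 := hL B
      rw [h1, map_sum, Finset.sum_eq_single B] at h2
      · exact h2
      · intro A hA hAB
        have hlt : B ⊂ A := lt_of_le_of_ne (Finset.mem_filter.1 hA).2 hAB.symm
        exact ih _ (hB ▸ Finset.card_lt_card (Finset.compl_ssubset_compl.2 hlt)) A rfl
      · simp
  refine LinearMap.pi_ext fun B x => ?_
  have : (Pi.single B x : Finset ι → ℝ) = x • Pi.single B 1 := by
    rw [← Pi.single_smul]; simp
  rw [this, map_smul, hs _ B rfl]
  simp

/-- The Shapley marginals do not depend on the exchangeable distribution used in `swing`. -/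
lemma marginalSum_swing_eq {n : ℕ} (q q' : Finset (Fin n) → ℝ)
    (hq : ∀ X Y, X.card = Y.card → q X = q Y) (hq1 : ∑ X, q X = 1)
    (hq' : ∀ X Y, X.card = Y.card → q' X = q' Y) (hq1' : ∑ X, q' X = 1)
    (G : Finset (Fin n) → ℝ) (i : Fin n) :
    marginalSum (swing q G) i = marginalSum (swing q' G) i := by
  let M : (Finset (Fin n) → ℝ) → (Finset (Fin n) → ℝ) →ₗ[ℝ] ℝ := fun r =>
    { toFun := fun G => marginalSum (swing r G) i
      map_add' := fun G H => by
        simp only [marginalSum, swing, Pi.add_apply, ← Finset.sum_add_distrib,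
          ← Finset.sum_sub_distrib]
        refine Finset.sum_congr rfl fun _ _ => Finset.sum_congr rfl fun _ _ => ?_
        ring
      map_smul' := fun c G => by
        simp only [marginalSum, swing, Pi.smul_apply, smul_eq_mul, RingHom.id_apply,
          Finset.mul_sum, ← Finset.sum_sub_distrib]
        refine Finset.sum_congr rfl fun _ _ => Finset.sum_congr rfl fun _ _ => ?_
        ring }
  have h : M q - M q' = 0 := linearMap_eq_zero_of_unanimity _ fun A =>
    sub_eq_zero.2 ((marginalSum_swing_unanimity q hq hq1 A i).trans
      (marginalSum_swing_unanimity q' hq' hq1' A i).symm)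
  exact LinearMap.congr_fun (sub_eq_zero.1 h) G

lemma bernoulli_weights_congr {n : ℕ} (p r : ℝ) :
    ∀ X Y : Finset (Fin n), X.card = Y.card →
      p ^ X.card * r ^ (n - X.card) = p ^ Y.card * r ^ (n - Y.card) := by
  intro X Y h
  rw [h]

lemma sum_bernoulli_weights {n : ℕ} (p r : ℝ) (h : p + r = 1) :
    ∑ X : Finset (Fin n), p ^ X.card * r ^ (n - X.card) = 1 := by
  rw [Fin.sum_pow_mul_eq_add_pow, h, one_pow]

/-- The profile in which exactly the players in `X` choose level `1`. -/
def profile {n : ℕ} (X : Finset (Fin n)) : Fin n → Fin 2 := fun j => if j ∈ X then 1 else 0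

lemma jkC_two_eq_swing {n k : ℕ} (v : (Fin n → ℕ) → ℕ) (T : Finset (Fin n)) :
    jkC n 2 k v T = swing (fun X => (1 / 2 : ℝ) ^ X.card * (1 / 2 : ℝ) ^ (n - X.card))
      (fun X => (v fun j => (profile X j : ℕ)) / ((k : ℝ) - 1)) T := by
  rw [jkC, swing, Finset.mul_sum]
  refine Finset.sum_bij' (fun x _ => Finset.univ.filter fun j => x j = 1) (fun X _ => profile X)
    (by simp) (by simp) ?_ ?_ ?_
  · intro x _
    ext j
    rcases Fin.exists_fin_two.1 ⟨x j, rfl⟩ with h | h <;> simp [profile, h]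
  · intro X _
    ext j
    simp [profile]
  · intro x _
    have h1 : (fun j => if j ∈ T then 2 - 1 else (x j : ℕ))
        = fun j => (profile ((Finset.univ.filter fun j => x j = 1) ∪ T) j : ℕ) := by
      ext j
      rcases Fin.exists_fin_two.1 ⟨x j, rfl⟩ with h | h <;> by_cases hj : j ∈ T <;>
        simp [profile, h, hj]
    have h0 : (fun j => if j ∈ T then 0 else (x j : ℕ))
        = fun j => (profile ((Finset.univ.filter fun j => x j = 1) \ T) j : ℕ) := by
      ext j
      rcases Fin.exists_fin_two.1 ⟨x j, rfl⟩ with h | h <;> by_cases hj : j ∈ T <;>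
        simp [profile, h, hj]
    have hc : (Finset.univ.filter fun j => x j = 1).card ≤ n := by
      simpa using (Finset.univ.filter fun j => x j = 1).card_le_univ
    rw [h1, h0, ← pow_add, Nat.add_sub_cancel' hc, Nat.cast_ofNat, one_div_pow]
    field_simp

lemma jkSSI_eq_marginalSum {n j k : ℕ} (v : (Fin n → ℕ) → ℕ) (i : Fin n) :
    jkSSI n j k v i = 1 / (n.factorial : ℝ) * marginalSum (jkC n j k v) i := by
  rw [jkSSI, marginalSum_eq_sum_subsets, Finset.mul_sum]
  refine Finset.sum_congr rfl fun S _ => ?_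
  ring

/-- The players whose coordinate exceeds the threshold `τ`. -/
noncomputable def above {n : ℕ} (τ : ℝ) (x : Fin n → ℝ) : Finset (Fin n) :=
  Finset.univ.filter fun j => τ < x j

@[simp] lemma mem_above {n : ℕ} {τ : ℝ} {x : Fin n → ℝ} {j : Fin n} :
    j ∈ above τ x ↔ τ < x j := by simp [above]

lemma integral_above {n : ℕ} {τ : ℝ} (hτ : 0 < τ) (hτ1 : τ < 1) (H : Finset (Fin n) → ℝ) :
    ∫ x in cube n, H (above τ x)
      = ∑ X, ((1 - τ) ^ X.card * τ ^ (n - X.card)) * H X := by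
  let I : Finset (Fin n) → Fin n → Set ℝ :=
    fun X j => if j ∈ X then Set.Ioc τ 1 else Set.Icc 0 τ
  let B : Finset (Fin n) → Set (Fin n → ℝ) := fun X => Set.univ.pi (I X)
  have hmem : ∀ X x, x ∈ B X ↔ x ∈ cube n ∧ above τ x = X := by
    intro X x
    simp only [B, Set.mem_univ_pi, cube, Set.mem_ofPred_eq, Finset.ext_iff, mem_above,
      ← forall_and, I]
    refine forall_congr' fun j => ?_
    by_cases hj : j ∈ X
    · simp only [hj, if_true, Set.mem_Ioc, Set.mem_Icc, iff_true]
      constructor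
      · rintro ⟨h1, h2⟩; exact ⟨⟨by linarith, h2⟩, h1⟩
      · rintro ⟨⟨h1, h2⟩, h3⟩; exact ⟨h3, h2⟩
    · simp only [hj, if_false, Set.mem_Icc, iff_false, not_lt]
      constructor
      · rintro ⟨h1, h2⟩; exact ⟨⟨h1, by linarith⟩, h2⟩
      · rintro ⟨⟨h1, h2⟩, h3⟩; exact ⟨h1, h3⟩
  have hmeas : ∀ X, MeasurableSet (B X) := fun X => by
    refine MeasurableSet.univ_pi fun j => ?_
    by_cases hj : j ∈ X <;> simp [I, hj]
  have hvol : ∀ X, volume (B X) = ENNReal.ofReal ((1 - τ) ^ X.card * τ ^ (n - X.card)) := by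
    intro X
    have : ∀ j, volume (I X j) = if j ∈ X then ENNReal.ofReal (1 - τ) else ENNReal.ofReal τ := by
      intro j
      by_cases hj : j ∈ X <;> simp [I, hj]
    rw [volume_pi_pi, Finset.prod_congr rfl fun j _ => this j, Finset.prod_ite]
    have hc : (Finset.univ.filter fun j => j ∉ X).card = n - X.card := by
      rw [← Finset.compl_filter, Finset.card_compl]
      simp
    rw [Finset.prod_const, Finset.prod_const, hc, ENNReal.ofReal_mul (by
      have : 0 ≤ 1 - τ := by linarith
      positivity), ENNReal.ofReal_pow (by linarith), ENNReal.ofReal_pow hτ.le]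
    simp
  have hcube : cube n = ⋃ X, B X := by
    ext x
    simp [hmem]
  have hconst : ∀ X, Set.EqOn (fun x => H (above τ x)) (fun _ => H X) (B X) := fun X x hx => by
    simp only [((hmem X x).1 hx).2]
  rw [hcube, integral_iUnion_fintype hmeas]
  · refine Finset.sum_congr rfl fun X _ => ?_
    rw [setIntegral_congr_fun (hmeas X) (hconst X), setIntegral_const, Measure.real, hvol,
      ENNReal.toReal_ofReal, smul_eq_mul]
    have : 0 ≤ 1 - τ := by linarith
    positivity
  · intro X Y hXY
    refine Set.disjoint_left.2 fun x hx hy => hXY ?_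
    rw [← ((hmem X x).1 hx).2, ((hmem Y x).1 hy).2]
  · intro X
    rw [integrableOn_congr_fun (hconst X) (hmeas X)]
    exact integrableOn_const (by rw [hvol]; exact ENNReal.ofReal_ne_top)

lemma ae_forall_ne {n : ℕ} (τ : ℝ) : ∀ᵐ x : Fin n → ℝ, ∀ j, x j ≠ τ := by
  rw [ae_all_iff]
  intro j
  exact (Measure.quasiMeasurePreserving_eval (fun _ : Fin n => (volume : Measure ℝ)) j).ae
    (Measure.ae_ne volume τ)

lemma regularStep_apply {n k : ℕ} (hk : 2 ≤ k) {τ : ℝ} (hτ : 0 < τ) (hτ1 : τ < 1)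
    {v : (Fin n → ℕ) → ℕ} (hv : IsJKGame n 2 k v)
    {vhat : (Fin n → ℝ) → ℝ} (hreg : RegularStep n 2 (tauDisc τ) vhat)
    (hval : ∀ eb : Fin n → Fin 2, ∀ x ∈ openBox n (tauDisc τ) (fullIdx eb),
      vhat x = (v (fun i => (eb i : ℕ)) : ℝ) / ((k : ℝ) - 1))
    {y : Fin n → ℝ} (hy : y ∈ cube n) (hyτ : ∀ j, y j ≠ τ) :
    vhat y = (v fun j => (profile (above τ y) j : ℕ)) / ((k : ℝ) - 1) := by
  obtain ⟨-, h0, h1, havg⟩ := hreg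
  by_cases hy0 : y = fun _ => 0
  · subst hy0
    have : (fun j => (profile (above τ fun _ : Fin n => (0 : ℝ)) j : ℕ)) = fun _ => 0 := by
      ext j
      simp [profile, hτ.le]
    rw [h0, this, hv.1]
    simp
  by_cases hy1 : y = fun _ => 1
  · subst hy1
    have : (fun j => (profile (above τ fun _ : Fin n => (1 : ℝ)) j : ℕ)) = fun _ => 2 - 1 := by
      ext j
      simp [profile, hτ1]
    have hk1 : (k : ℝ) - 1 ≠ 0 := by
      have : (2 : ℝ) ≤ k := by exact_mod_cast hk
      linarith
    rw [h1, this, hv.2.1, Nat.cast_sub (by omega), Nat.cast_one, div_self hk1]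
  have hE : Ecal n 2 (tauDisc τ) y = {profile (above τ y)} := by
    ext eb
    classical
    rw [Ecal, Finset.mem_filter]
    simp only [Finset.mem_univ, true_and, Finset.mem_singleton,
      closedBox, Set.mem_ofPred_eq, funext_iff, fullIdx]
    refine forall_congr' fun j => ?_
    have hyj := hy j
    have hne := hyτ j
    rcases Fin.exists_fin_two.1 ⟨eb j, rfl⟩ with h | h <;> rcases lt_or_gt_of_ne hne with hlt | hlt
    · simp [h, profile, tauDisc, hlt.le, hyj.1]
    · simp [h, profile, tauDisc, hlt]
    · simp [h, profile, tauDisc, hlt, hlt.le]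
    · simp [h, profile, tauDisc, hlt, hlt.le, hyj.2]
  rw [havg y hy hy0 hy1, hE, Finset.sum_singleton, Finset.card_singleton, Nat.cast_one, div_one]
  refine hval _ _ fun j => ?_
  by_cases hj : τ < y j
  · simp only [fullIdx, center, profile, mem_above, hj, if_true, tauDisc]
    norm_num
    constructor <;> linarith
  · simp only [fullIdx, center, profile, mem_above, hj, if_false, tauDisc]
    norm_num
    exact hτ

lemma Psi_eq_marginalSum {n k : ℕ} (hk : 2 ≤ k) {τ : ℝ} (hτ : 0 < τ) (hτ1 : τ < 1)
    {v : (Fin n → ℕ) → ℕ} (hv : IsJKGame n 2 k v)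
    {vhat : (Fin n → ℝ) → ℝ} (hreg : RegularStep n 2 (tauDisc τ) vhat)
    (hval : ∀ eb : Fin n → Fin 2, ∀ x ∈ openBox n (tauDisc τ) (fullIdx eb),
      vhat x = (v (fun i => (eb i : ℕ)) : ℝ) / ((k : ℝ) - 1)) (i : Fin n) :
    Psi n vhat i = 1 / (n.factorial : ℝ) *
      marginalSum (swing (fun X => (1 - τ) ^ X.card * τ ^ (n - X.card))
        (fun X => (v fun j => (profile X j : ℕ)) / ((k : ℝ) - 1))) i := by
  set G : Finset (Fin n) → ℝ := fun X => (v fun j => (profile X j : ℕ)) / ((k : ℝ) - 1)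
  have hone : ∀ (P : Fin n → Prop) [DecidablePred P] (T : Finset (Fin n)) (x : Fin n → ℝ),
      (∀ j, P j ↔ j ∉ T) → x ∈ cube n → (∀ j, x j ≠ τ) →
      vhat (fun j => if P j then x j else 1) = G (above τ x ∪ T) ∧
      vhat (fun j => if P j then x j else 0) = G (above τ x \ T) := by
    intro P _ T x hP hx hxτ
    have h1 : above τ (fun j => if P j then x j else 1) = above τ x ∪ T := by
      ext j
      by_cases hj : j ∈ T <;> simp [hP, hj, hτ1]
    have h0 : above τ (fun j => if P j then x j else 0) = above τ x \ T := by
      ext j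
      by_cases hj : j ∈ T <;> simp [hP, hj, hτ.le]
    rw [← h1, ← h0]
    constructor
    · refine regularStep_apply hk hτ hτ1 hv hreg hval (fun j => ?_) fun j => ?_
      · by_cases hj : P j
        · simpa [hj] using hx j
        · simp [hj]
      · by_cases hj : P j
        · simpa [hj] using hxτ j
        · simpa [hj] using hτ1.ne'
    · refine regularStep_apply hk hτ hτ1 hv hreg hval (fun j => ?_) fun j => ?_
      · by_cases hj : P j
        · simpa [hj] using hx j
        · simp [hj]
      · by_cases hj : P j
        · simpa [hj] using hxτ j
        · simpa [hj] using hτ.ne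
  rw [Psi, marginalSum]
  congr 1
  refine Finset.sum_congr rfl fun π _ => ?_
  have hcubem : MeasurableSet (cube n) := by
    have : cube n = Set.univ.pi fun _ => Set.Icc (0 : ℝ) 1 := by
      ext x; simp only [cube, Set.mem_univ_pi, Set.mem_ofPred_eq]
    rw [this]
    exact MeasurableSet.univ_pi fun _ => measurableSet_Icc
  let H : Finset (Fin n) → ℝ := fun X =>
    (G (X ∪ upSet π i) - G (X \ upSet π i)) -
      (G (X ∪ (upSet π i).erase i) - G (X \ (upSet π i).erase i))
  have hae : ∀ᵐ x : Fin n → ℝ, x ∈ cube n →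
      ((vhat (fun j => if π j < π i then x j else 1) -
        vhat (fun j => if π j < π i then x j else 0)) -
       (vhat (fun j => if π j ≤ π i then x j else 1) -
        vhat (fun j => if π j ≤ π i then x j else 0))) = H (above τ x) := by
    filter_upwards [ae_forall_ne τ] with x hxτ hx
    obtain ⟨a1, a0⟩ := hone (fun j => π j < π i) (upSet π i) x (by simp) hx hxτ
    obtain ⟨b1, b0⟩ := hone (fun j => π j ≤ π i) ((upSet π i).erase i) x (fun j => by
      rw [Finset.mem_erase, mem_upSet, ← π.injective.ne_iff, le_iff_eq_or_lt, ← not_le]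
      tauto) hx hxτ
    rw [a1, a0, b1, b0]
  rw [setIntegral_congr_ae hcubem hae, integral_above hτ hτ1, swing, swing,
    ← Finset.sum_sub_distrib]
  refine Finset.sum_congr rfl fun X _ => ?_
  ring

/-- Let `v` be a `(2,k)` simple game, `τ ∈ (0,1)`, and let `v̂` be the
regular step function with discretization `(0, τ, 1)` determined by
`v̂(x) = v(ē − 1/2·1)/(k−1)` on each full-dimensional open box. Then `SSI(v) = Ψ(v̂)`,
independently of `τ`. -/
theorem natural_embedding_2k_SSI_eq_Psi (n : ℕ) (hn : 1 ≤ n) (k : ℕ) (hk : 2 ≤ k)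
    (τ : ℝ) (hτ : 0 < τ) (hτ1 : τ < 1) (v : (Fin n → ℕ) → ℕ) (hv : IsJKGame n 2 k v)
    (vhat : (Fin n → ℝ) → ℝ) (hreg : RegularStep n 2 (tauDisc τ) vhat)
    (hval : ∀ eb : Fin n → Fin 2, ∀ x ∈ openBox n (tauDisc τ) (fullIdx eb),
      vhat x = (v (fun i => (eb i : ℕ)) : ℝ) / ((k : ℝ) - 1)) :
    ∀ i : Fin n, jkSSI n 2 k v i = Psi n vhat i := by
  intro i
  rw [jkSSI_eq_marginalSum, Psi_eq_marginalSum hk hτ hτ1 hv hreg hval,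
    funext (jkC_two_eq_swing v)]
  congr 1
  exact marginalSum_swing_eq _ _
    (bernoulli_weights_congr _ _) (sum_bernoulli_weights _ _ (by norm_num))
    (bernoulli_weights_congr _ _) (sum_bernoulli_weights _ _ (by ring)) _ i
end

section
/- Let v be a simple game on N, i.e. a map v : 2^N → {0,1} with v(∅) = 0, v(N) = 1, and v(S) ≤ v(T) for S ⊆ T. Define ṽ : [0,1]^n → [0,1] by ṽ(x) = 1 if {i ∈ N : x_i = 1} is a winning coalition of v (i.e. has v-value 1) and ṽ(x) = 0 otherwise. Then ṽ is an interval simple game that is a semi-regular step function with discretization (0,1), and SSI_i(v) = Ψ_i(ṽ) for all i ∈ N, where SSI_i(v) = Σ_{S : i∈S⊆N} ((s−1)!(n−s)!/n!)·(v(S) − v(S∖{i})) with s = |S| is the Shapley–Shubik index of the simple game v. -/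
open MeasureTheory

/-- A simple game on `N`: a monotone map `2^N → {0,1}` with `v(∅) = 0`, `v(N) = 1`. -/
def IsSimpleGame (n : ℕ) (v : Finset (Fin n) → ℕ) : Prop :=
  v ∅ = 0 ∧ v Finset.univ = 1 ∧ (∀ S, v S = 0 ∨ v S = 1) ∧
  (∀ S T : Finset (Fin n), S ⊆ T → v S ≤ v T)

/-- The Shapley–Shubik index of a simple game. -/
noncomputable def sgSSI (n : ℕ) (v : Finset (Fin n) → ℕ) (i : Fin n) : ℝ :=
  ∑ S ∈ Finset.univ.powerset.filter (fun S : Finset (Fin n) => i ∈ S),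
    (((S.card - 1).factorial * (n - S.card).factorial : ℕ) : ℝ) / (n.factorial : ℝ) *
      ((v S : ℝ) - (v (S.erase i) : ℝ))

open Classical in
/-- The embedding `ṽ` of a simple game: `ṽ(x) = 1` if `{i : x_i = 1}` is winning, else `0`. -/
noncomputable def tildeGame (n : ℕ) (v : Finset (Fin n) → ℕ) : (Fin n → ℝ) → ℝ :=
  fun x => if v (Finset.univ.filter fun i => x i = 1) = 1 then 1 else 0

/-- The discretization `α = (0, 1)` (with `p = 1`). -/
def twoDisc : ℕ → ℝ := fun m => if m = 0 then 0 else 1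

lemma tildeGame_eq_zero {n : ℕ} {v : Finset (Fin n) → ℕ} (hv : IsSimpleGame n v)
    {x : Fin n → ℝ} (hx : ∀ j, x j ≠ 1) : tildeGame n v x = 0 := by
  classical
  simp [tildeGame, hx, hv.1]

lemma tildeGame_eq {n : ℕ} {v : Finset (Fin n) → ℕ} (hv : IsSimpleGame n v)
    {x : Fin n → ℝ} {S : Finset (Fin n)} (hx : ∀ j, x j = 1 ↔ j ∈ S) :
    tildeGame n v x = v S := by
  classical
  have h : (Finset.univ.filter fun i => x i = 1) = S := by ext j; simp [hx]
  rcases hv.2.2.1 S with h' | h' <;> simp [tildeGame, h, h']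

lemma isISG_tildeGame {n : ℕ} {v : Finset (Fin n) → ℕ} (hv : IsSimpleGame n v) :
    IsISG n (tildeGame n v) := by
  classical
  refine ⟨tildeGame_eq_zero hv (by simp), ?_, ?_, ?_⟩
  · rw [tildeGame_eq hv (S := Finset.univ) (by simp), hv.2.1, Nat.cast_one]
  · intro x _
    unfold tildeGame
    split_ifs <;> simp
  · intro x _ y hy hxy
    rw [tildeGame_eq hv (x := x) (S := Finset.univ.filter fun i => x i = 1) (by simp),
      tildeGame_eq hv (x := y) (S := Finset.univ.filter fun i => y i = 1) (by simp)]
    refine Nat.cast_le.mpr (hv.2.2.2 _ _ fun j hj => ?_)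
    simp only [Finset.mem_filter, Finset.mem_univ, true_and] at hj ⊢
    exact le_antisymm (hy j).2 (hj ▸ hxy j)

lemma semiRegularStep_tildeGame {n : ℕ} {v : Finset (Fin n) → ℕ} (hv : IsSimpleGame n v) :
    SemiRegularStep n 1 twoDisc (tildeGame n v) := by
  classical
  refine ⟨fun e he x hx y hy => ?_, fun x hx => ?_⟩
  · rw [tildeGame_eq hv (x := x) (S := Finset.univ.filter fun i => x i = 1) (by simp)]
    refine (tildeGame_eq hv fun j => ?_).symm
    have hxj := hx j
    have hyj := hy j
    have hej := he j
    simp only [Finset.mem_filter, Finset.mem_univ, true_and]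
    interval_cases e j <;> simp [twoDisc] at hxj hyj
    · simp [hxj, hyj]
    · simp [hxj.2.ne, hyj.2.ne]
    · simp [hxj, hyj]
  · rw [tildeGame_eq_zero hv fun j => (hx j).2.ne, Finset.sum_eq_zero, zero_div]
    refine fun eb _ => tildeGame_eq_zero hv fun j => ?_
    have : eb j = 0 := Subsingleton.elim _ _
    norm_num [center, fullIdx, twoDisc, this]

/-- The set of `j` placed weakly after `i` by `π`. -/
def tailSet {n : ℕ} (i : Fin n) (π : Equiv.Perm (Fin n)) : Finset (Fin n) :=
  Finset.univ.filter fun j => π i ≤ π j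

lemma erase_tailSet {n : ℕ} (i : Fin n) (π : Equiv.Perm (Fin n)) :
    (tailSet i π).erase i = Finset.univ.filter fun j => π i < π j := by
  ext j
  simp only [tailSet, Finset.mem_erase, Finset.mem_filter, Finset.mem_univ, true_and,
    lt_iff_le_and_ne, ne_eq, π.injective.eq_iff]
  tauto

lemma setIntegral_cube_const (n : ℕ) {f : (Fin n → ℝ) → ℝ} {c : ℝ}
    (hf : ∀ x : Fin n → ℝ, (∀ j, 0 < x j ∧ x j < 1) → f x = c) :
    ∫ x in cube n, f x = c := by
  have hcube : cube n = Set.Icc (fun _ => (0 : ℝ)) (fun _ => 1) := by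
    ext x
    simp [cube, Pi.le_def, forall_and]
  have hae : (Set.univ.pi fun _ : Fin n => Set.Ioo (0 : ℝ) 1) =ᵐ[volume] cube n := by
    rw [hcube]
    exact Measure.univ_pi_Ioo_ae_eq_Icc
  rw [← setIntegral_congr_set hae,
    setIntegral_congr_fun (g := fun _ => c)
      (MeasurableSet.univ_pi fun _ => measurableSet_Ioo) fun x hx => hf x fun j => hx j trivial]
  simp [measureReal_def, Real.volume_pi_Ioo]

lemma Psi_tildeGame {n : ℕ} {v : Finset (Fin n) → ℕ} (hv : IsSimpleGame n v) (i : Fin n) :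
    Psi n (tildeGame n v) i = (1 / (n.factorial : ℝ)) *
      ∑ π : Equiv.Perm (Fin n), ((v (tailSet i π) : ℝ) - v ((tailSet i π).erase i)) := by
  unfold Psi
  congr 1
  refine Finset.sum_congr rfl fun π _ => setIntegral_cube_const n fun x hx => ?_
  have hx1 : ∀ j, x j ≠ 1 := fun j => (hx j).2.ne
  rw [tildeGame_eq hv (S := tailSet i π), tildeGame_eq_zero hv,
    tildeGame_eq hv (S := (tailSet i π).erase i), tildeGame_eq_zero hv]
  · ring
  · intro j
    split_ifs <;> simp [hx1]
  · intro j
    rw [erase_tailSet]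
    split_ifs with h <;> simp [hx1, h]
    exact not_le.mp h
  · intro j
    split_ifs <;> simp [hx1]
  · intro j
    split_ifs with h <;> simp [hx1, h, tailSet]
    exact not_lt.mp h

/-- Labels the elements outside `S` by `0`, the element `i` by `1` and the rest of `S` by `2`. -/
def tailLabel {n : ℕ} (i : Fin n) (S : Finset (Fin n)) (j : Fin n) : Fin 3 :=
  if j ∈ S then (if j = i then 1 else 2) else 0

/-- Labels a position by its comparison with the position `c`. -/
def posLabel {n : ℕ} (c k : Fin n) : Fin 3 :=
  if c ≤ k then (if k = c then 1 else 2) else 0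

lemma posLabel_comp {n : ℕ} (i : Fin n) (π : Equiv.Perm (Fin n)) :
    posLabel (π i) ∘ π = tailLabel i (tailSet i π) := by
  ext j
  simp [posLabel, tailLabel, tailSet]

lemma tailSet_eq_of_posLabel_comp {n : ℕ} {i c : Fin n} {S : Finset (Fin n)} (hi : i ∈ S)
    {π : Equiv.Perm (Fin n)} (h : posLabel c ∘ π = tailLabel i S) : tailSet i π = S := by
  have hc : π i = c := by
    have := congrFun h i
    simp only [posLabel, tailLabel, Function.comp, hi, if_true] at this
    split_ifs at this <;> simp_all
  subst hc
  ext j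
  have := congrFun h j
  simp only [posLabel, tailLabel, Function.comp] at this
  simp only [tailSet, Finset.mem_filter, Finset.mem_univ, true_and]
  split_ifs at this <;> simp_all

lemma exists_tailSet_eq {n : ℕ} {i : Fin n} {S : Finset (Fin n)} (hi : i ∈ S) :
    ∃ π : Equiv.Perm (Fin n), tailSet i π = S := by
  refine ⟨(Tuple.sort (tailLabel i S))⁻¹, ?_⟩
  have hm := Tuple.monotone_sort (tailLabel i S)
  have key : ∀ a b, tailLabel i S a < tailLabel i S b →
      (Tuple.sort (tailLabel i S))⁻¹ a < (Tuple.sort (tailLabel i S))⁻¹ b := by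
    intro a b hab
    by_contra hle
    have := hm (not_lt.mp hle)
    simp only [Function.comp, Equiv.Perm.inv_def, Equiv.apply_symm_apply] at this
    exact absurd hab (not_lt.mpr this)
  ext j
  simp only [tailSet, Finset.mem_filter, Finset.mem_univ, true_and]
  by_cases hj : j ∈ S
  · by_cases hji : j = i
    · simp [hji, hi]
    · exact iff_of_true (key i j (by simp [tailLabel, hi, hj, hji])).le hj
  · exact iff_of_false (not_le.mpr (key j i (by simp [tailLabel, hi, hj]))) hj

lemma card_tailSet {n : ℕ} (i : Fin n) (π : Equiv.Perm (Fin n)) :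
    (tailSet i π).card = n - π i := by
  rw [← Fin.card_Ici, ← Finset.card_map π.toEmbedding]
  congr 1
  ext k
  simp only [tailSet, Finset.mem_map_equiv, Finset.mem_filter, Finset.mem_univ, true_and,
    Equiv.apply_symm_apply, Finset.mem_Ici]

lemma card_filter_tailSet_eq {n : ℕ} {i : Fin n} {S : Finset (Fin n)} (hi : i ∈ S) :
    (Finset.univ.filter fun π : Equiv.Perm (Fin n) => tailSet i π = S).card =
      (S.card - 1).factorial * (n - S.card).factorial := by
  obtain ⟨π₀, h₀⟩ := exists_tailSet_eq hi
  have hpos : posLabel (π₀ i) ∘ π₀ = tailLabel i S := h₀ ▸ posLabel_comp i π₀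
  have hiff : ∀ π : Equiv.Perm (Fin n),
      tailSet i (π₀ * π) = S ↔ tailLabel i S ∘ π = tailLabel i S := by
    intro π
    rw [← hpos, Function.comp_assoc, ← Equiv.Perm.coe_mul, hpos]
    refine ⟨fun h => ?_, tailSet_eq_of_posLabel_comp hi⟩
    have hc : (π₀ * π) i = π₀ i := by
      have h1 := card_tailSet i π₀
      have h2 := card_tailSet i (π₀ * π)
      rw [h₀] at h1
      rw [h] at h2
      ext
      omega
    rw [← hc, posLabel_comp, h]
  have hcard := DomMulAct.stabilizer_card (tailLabel i S)
  rw [Fin.prod_univ_three] at hcard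
  have c0 : Fintype.card {a // tailLabel i S a = 0} = n - S.card := by
    rw [Fintype.card_of_subtype Sᶜ, Finset.card_compl, Fintype.card_fin]
    intro j
    rw [Finset.mem_compl, tailLabel]
    split_ifs <;> simp_all
  have c1 : Fintype.card {a // tailLabel i S a = 1} = 1 := by
    rw [Fintype.card_of_subtype {i}, Finset.card_singleton]
    intro j
    rw [Finset.mem_singleton, tailLabel]
    split_ifs <;> simp_all
    rintro rfl
    contradiction
  have c2 : Fintype.card {a // tailLabel i S a = 2} = S.card - 1 := by
    rw [Fintype.card_of_subtype (S.erase i), Finset.card_erase_of_mem hi]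
    intro j
    rw [Finset.mem_erase, tailLabel]
    split_ifs <;> simp_all
  rw [c0, c1, c2, Fintype.card_subtype, Nat.factorial_one, mul_one, mul_comm] at hcard
  rw [← hcard]
  symm
  refine Finset.card_equiv (Equiv.mulLeft π₀) fun π => ?_
  simp [hiff]

lemma sgSSI_eq_sum_perm (n : ℕ) (v : Finset (Fin n) → ℕ) (i : Fin n) :
    sgSSI n v i = (1 / (n.factorial : ℝ)) *
      ∑ π : Equiv.Perm (Fin n), ((v (tailSet i π) : ℝ) - v ((tailSet i π).erase i)) := by
  have hmaps : ∀ π ∈ (Finset.univ : Finset (Equiv.Perm (Fin n))),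
      tailSet i π ∈ Finset.univ.powerset.filter (fun S : Finset (Fin n) => i ∈ S) := by
    simp [tailSet]
  rw [← Finset.sum_fiberwise_of_maps_to hmaps, Finset.mul_sum, sgSSI]
  refine Finset.sum_congr rfl fun S hS => ?_
  rw [Finset.sum_congr rfl (g := fun _ => (v S : ℝ) - v (S.erase i)), Finset.sum_const,
    card_filter_tailSet_eq (Finset.mem_filter.mp hS).2, nsmul_eq_mul]
  · ring
  · intro π hπ
    rw [(Finset.mem_filter.mp hπ).2]

/-- For a simple game `v`, the function `ṽ` is an interval simple game
that is a semi-regular step function with discretization `(0,1)`, and `SSI(v) = Ψ(ṽ)`. -/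
theorem simple_game_embedding (n : ℕ) (hn : 1 ≤ n) (v : Finset (Fin n) → ℕ)
    (hv : IsSimpleGame n v) :
    IsISG n (tildeGame n v) ∧ SemiRegularStep n 1 twoDisc (tildeGame n v) ∧
    ∀ i : Fin n, sgSSI n v i = Psi n (tildeGame n v) i := by
  exact ⟨isISG_tildeGame hv, semiRegularStep_tildeGame hv, fun i => by
    rw [sgSSI_eq_sum_perm, Psi_tildeGame hv]⟩
end
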